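/- arXiv:2010.07902 — 2 statements merged into one kernel-verified Lean document; each statement's English description precedes it below -/
import Mathlib

section
/- Let ρ be a quantum state on a composite system X_1 ⊗ … ⊗ X_n of finite-dimensional systems (possibly of different dimensions), and let μ, m be integers with 1 ≤ μ < m ≤ n. Then E_{|I|=m} S(X_I)_ρ ≤ (m/μ) · E_{|J|=μ} S(X_J)_ρ, where both expectations are uniform averages over subsets of {1,…,n} of the indicated cardinality. -/
open scoped BigOperators ComplexOrder

/-- Von Neumann entropy of a matrix: `-∑ λ_j log λ_j` over the eigenvalues,
if the matrix is Hermitian (else junk value 0). Natural logarithm,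
with the convention `0 * log 0 = 0` (automatic since `Real.log 0 = 0`). -/
noncomputable def vnEntropy {m : Type*} [Fintype m] [DecidableEq m]
    (ρ : Matrix m m ℂ) : ℝ :=
  if h : ρ.IsHermitian then
    -∑ j, h.eigenvalues j * Real.log (h.eigenvalues j)
  else 0

/-- Marginal (partial trace) of a state on the composite system
`⨂_{i : ι} X_i` (with `X_i = ℂ^{dim i}`), keeping the factors in `S`. -/
noncomputable def marginal {ι : Type*} [Fintype ι] [DecidableEq ι]
    {dim : ι → ℕ}
    (ρ : Matrix ((i : ι) → Fin (dim i)) ((i : ι) → Fin (dim i)) ℂ)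
    (S : Finset ι) :
    Matrix ((i : {j : ι // j ∈ S}) → Fin (dim i.1))
           ((i : {j : ι // j ∈ S}) → Fin (dim i.1)) ℂ :=
  fun x y =>
    ∑ z : (i : {j : ι // j ∉ S}) → Fin (dim i.1),
      ρ (fun i => if h : i ∈ S then x ⟨i, h⟩ else z ⟨i, h⟩)
        (fun i => if h : i ∈ S then y ⟨i, h⟩ else z ⟨i, h⟩)

/-- Entropy of the marginal of `ρ` on the factors in `S`. -/
noncomputable def mEnt {ι : Type*} [Fintype ι] [DecidableEq ι]
    {dim : ι → ℕ}
    (ρ : Matrix ((i : ι) → Fin (dim i)) ((i : ι) → Fin (dim i)) ℂ)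
    (S : Finset ι) : ℝ :=
  vnEntropy (marginal ρ S)



theorem hasDerivAt_logsum {I : Type*} [Fintype I] (w p q : I → ℝ)
    (hp : ∀ i, 0 ≤ p i) (hq : ∀ i, 0 < q i) (t : ℝ) (ht : 0 ≤ t) :
    HasDerivAt (fun t => ∑ i, w i * (p i * Real.log (q i + t * p i)))
      (∑ i, w i * (p i ^ 2 / (q i + t * p i))) t := by
  apply HasDerivAt.fun_sum
  intro i _
  have hpos : 0 < q i + t * p i := add_pos_of_pos_of_nonneg (hq i) (mul_nonneg ht (hp i))
  have h := (((((hasDerivAt_id t).mul_const (p i)).const_add (q i)).log hpos.ne').const_mul (p i)).const_mul (w i)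
  refine h.congr_deriv ?_
  simp only [id]
  ring

theorem tendsto_logsum {I : Type*} [Fintype I] (w p q : I → ℝ)
    (hp : ∀ i, 0 ≤ p i) (hq : ∀ i, 0 < q i) :
    Filter.Tendsto (fun t => ∑ i, w i * (p i * Real.log (q i + t * p i)) - (∑ i, w i * p i) * Real.log t)
      Filter.atTop (nhds (∑ i, w i * (p i * Real.log (p i)))) := by
  have : ∀ᶠ t : ℝ in Filter.atTop, ∑ i, w i * (p i * Real.log (q i * t⁻¹ + p i)) =
     ∑ i, w i * (p i * Real.log (q i + t * p i)) - (∑ i, w i * p i) * Real.log t := by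
    filter_upwards [Filter.eventually_gt_atTop 0] with t ht
    rw [Finset.sum_mul, ← Finset.sum_sub_distrib]
    apply Finset.sum_congr rfl
    intro i _
    have hpos : 0 < q i + t * p i := add_pos_of_pos_of_nonneg (hq i) (mul_nonneg ht.le (hp i))
    have : q i * t⁻¹ + p i = (q i + t * p i) / t := by field_simp
    rw [this, Real.log_div hpos.ne' ht.ne']
    ring
  refine Filter.Tendsto.congr' this ?_
  apply tendsto_finsetSum
  intro i _
  rcases (hp i).eq_or_lt with h | h
  · simp [← h]
  · apply Filter.Tendsto.const_mul
    apply Filter.Tendsto.const_mul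
    have h1 : Filter.Tendsto (fun t : ℝ => q i * t⁻¹ + p i) Filter.atTop (nhds (q i * 0 + p i)) :=
      (tendsto_inv_atTop_zero.const_mul _).add_const _
    simp only [mul_zero, zero_add] at h1
    exact h1.log h.ne'

theorem scalar_ineq {I I' : Type*} [Fintype I] [Fintype I'] (w p q : I → ℝ) (w' p' q' : I' → ℝ)
    (hp : ∀ i, 0 ≤ p i) (hq : ∀ i, 0 < q i) (hp' : ∀ i, 0 ≤ p' i) (hq' : ∀ i, 0 < q' i)
    (hQ : ∀ t : ℝ, 0 ≤ t → ∑ i, w' i * (p' i ^ 2 / (q' i + t * p' i)) ≤ ∑ i, w i * (p i ^ 2 / (q i + t * p i)))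
    (htr : ∑ i, w' i * p' i = ∑ i, w i * p i) :
    ∑ i, w' i * (p' i * Real.log (p' i)) - ∑ i, w' i * (p' i * Real.log (q' i)) ≤
    ∑ i, w i * (p i * Real.log (p i)) - ∑ i, w i * (p i * Real.log (q i)) := by
  set G : ℝ → ℝ := fun t => ∑ i, w i * (p i * Real.log (q i + t * p i))
  set G' : ℝ → ℝ := fun t => ∑ i, w' i * (p' i * Real.log (q' i + t * p' i))
  have hd : ∀ t, 0 ≤ t → HasDerivAt (fun t => G t - G' t) _ t := fun t ht =>
    (hasDerivAt_logsum w p q hp hq t ht).sub (hasDerivAt_logsum w' p' q' hp' hq' t ht)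
  have hmono : MonotoneOn (fun t => G t - G' t) (Set.Ici 0) := by
    apply monotoneOn_of_deriv_nonneg (convex_Ici 0)
    · intro t ht
      exact (hd t ht).continuousAt.continuousWithinAt
    · intro t ht
      rw [interior_Ici] at ht
      exact (hd t (le_of_lt ht)).differentiableAt.differentiableWithinAt
    · intro t ht
      rw [interior_Ici] at ht
      rw [(hd t (le_of_lt ht)).deriv]
      exact sub_nonneg.2 (hQ t (le_of_lt ht))
  have hl := (tendsto_logsum w p q hp hq).sub (tendsto_logsum w' p' q' hp' hq')
  have h0 : G 0 - G' 0 ≤ ∑ i, w i * (p i * Real.log (p i)) - ∑ i, w' i * (p' i * Real.log (p' i)) := by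
    refine ge_of_tendsto hl ?_
    filter_upwards [Filter.eventually_ge_atTop 0] with t ht
    have := hmono (Set.mem_Ici.2 le_rfl) (Set.mem_Ici.2 ht) ht
    simp only at this
    rw [htr]
    simp only [G, G'] at this ⊢
    linarith
  simp only [G, G', zero_mul, add_zero] at h0
  linarith

/-- variational functional -/
noncomputable def Ffun {N : Type*} [Fintype N] (t : ℝ) (ρ σ X : Matrix N N ℂ) : ℝ :=
  2 * (ρ * X).trace.re - (σ * (X.conjTranspose * X)).trace.re - t * (ρ * (X * X.conjTranspose)).trace.re

theorem Ffun_eq {N : Type*} [Fintype N] [DecidableEq N] (t : ℝ) (U V Y : Matrix N N ℂ) (p q : N → ℝ)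
    (hU : U.conjTranspose * U = 1) (hV : V.conjTranspose * V = 1) :
    Ffun t (U * Matrix.diagonal (fun i => (p i : ℂ)) * U.conjTranspose)
      (V * Matrix.diagonal (fun i => (q i : ℂ)) * V.conjTranspose) (U * Y * V.conjTranspose) =
    ∑ x : N × N, (2 * p x.1 * (Y x.1 x.2 * star ((U.conjTranspose * V) x.1 x.2)).re
      - (q x.2 + t * p x.1) * Complex.normSq (Y x.1 x.2)) := by
  have h1 : (U * Matrix.diagonal (fun i => (p i : ℂ)) * U.conjTranspose * (U * Y * V.conjTranspose)).trace
      = (Matrix.diagonal (fun i => (p i : ℂ)) * (Y * (U.conjTranspose * V).conjTranspose)).trace := by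
    have : U * Matrix.diagonal (fun i => (p i : ℂ)) * U.conjTranspose * (U * Y * V.conjTranspose)
      = U * (Matrix.diagonal (fun i => (p i : ℂ)) * (U.conjTranspose * U) * Y * V.conjTranspose) := by
      simp only [Matrix.mul_assoc]
    rw [this, hU, Matrix.trace_mul_comm]
    simp [Matrix.mul_assoc, Matrix.conjTranspose_mul]
  have h2 : (V * Matrix.diagonal (fun i => (q i : ℂ)) * V.conjTranspose *
      ((U * Y * V.conjTranspose).conjTranspose * (U * Y * V.conjTranspose))).trace
      = (Matrix.diagonal (fun i => (q i : ℂ)) * (Y.conjTranspose * Y)).trace := by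
    have : V * Matrix.diagonal (fun i => (q i : ℂ)) * V.conjTranspose *
      ((U * Y * V.conjTranspose).conjTranspose * (U * Y * V.conjTranspose))
      = V * (Matrix.diagonal (fun i => (q i : ℂ)) * (V.conjTranspose * V) * Y.conjTranspose *
        (U.conjTranspose * U) * Y * V.conjTranspose) := by
      simp only [Matrix.mul_assoc, Matrix.conjTranspose_mul, Matrix.conjTranspose_conjTranspose]
    rw [this, hU, hV, Matrix.trace_mul_comm, Matrix.mul_assoc, hV]
    simp [Matrix.mul_assoc]
  have h3 : (U * Matrix.diagonal (fun i => (p i : ℂ)) * U.conjTranspose *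
      ((U * Y * V.conjTranspose) * (U * Y * V.conjTranspose).conjTranspose)).trace
      = (Matrix.diagonal (fun i => (p i : ℂ)) * (Y * Y.conjTranspose)).trace := by
    have : U * Matrix.diagonal (fun i => (p i : ℂ)) * U.conjTranspose *
      ((U * Y * V.conjTranspose) * (U * Y * V.conjTranspose).conjTranspose)
      = U * (Matrix.diagonal (fun i => (p i : ℂ)) * (U.conjTranspose * U) * Y *
        (V.conjTranspose * V) * Y.conjTranspose * U.conjTranspose) := by
      simp only [Matrix.mul_assoc, Matrix.conjTranspose_mul, Matrix.conjTranspose_conjTranspose]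
    rw [this, hU, hV, Matrix.trace_mul_comm, Matrix.mul_assoc, hU]
    simp [Matrix.mul_assoc]
  have e1 : (Matrix.diagonal (fun i => (p i : ℂ)) * (Y * (U.conjTranspose * V).conjTranspose)).trace.re
      = ∑ i, ∑ j, p i * (Y i j * star ((U.conjTranspose * V) i j)).re := by
    rw [Matrix.trace, Complex.re_sum]
    refine Finset.sum_congr rfl fun i _ => ?_
    rw [Matrix.diag_apply, Matrix.diagonal_mul, Matrix.mul_apply, Complex.re_ofReal_mul, Complex.re_sum,
      Finset.mul_sum]
    simp only [Matrix.conjTranspose_apply]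
  have e3 : (Matrix.diagonal (fun i => (p i : ℂ)) * (Y * Y.conjTranspose)).trace.re
      = ∑ i, ∑ j, p i * Complex.normSq (Y i j) := by
    rw [Matrix.trace, Complex.re_sum]
    refine Finset.sum_congr rfl fun i _ => ?_
    rw [Matrix.diag_apply, Matrix.diagonal_mul, Matrix.mul_apply, Complex.re_ofReal_mul, Complex.re_sum,
      Finset.mul_sum]
    simp only [Matrix.conjTranspose_apply, Complex.star_def, Complex.mul_conj, Complex.ofReal_re]
  have e2 : (Matrix.diagonal (fun i => (q i : ℂ)) * (Y.conjTranspose * Y)).trace.re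
      = ∑ i, ∑ j, q j * Complex.normSq (Y i j) := by
    rw [Finset.sum_comm, Matrix.trace, Complex.re_sum]
    refine Finset.sum_congr rfl fun i _ => ?_
    rw [Matrix.diag_apply, Matrix.diagonal_mul, Matrix.mul_apply, Complex.re_ofReal_mul, Complex.re_sum,
      Finset.mul_sum]
    simp only [Matrix.conjTranspose_apply, Complex.star_def, mul_comm _ (Y _ _), Complex.mul_conj, Complex.ofReal_re]
  rw [Ffun, h1, h2, h3, e1, e2, e3, Fintype.sum_prod_type, Finset.mul_sum, Finset.mul_sum,
    ← Finset.sum_sub_distrib, ← Finset.sum_sub_distrib]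
  refine Finset.sum_congr rfl fun i _ => ?_
  rw [Finset.mul_sum, Finset.mul_sum,
    ← Finset.sum_sub_distrib, ← Finset.sum_sub_distrib]
  refine Finset.sum_congr rfl fun j _ => ?_
  ring

theorem Ffun_le {N : Type*} [Fintype N] [DecidableEq N] (t : ℝ) (ht : 0 ≤ t) (U V X : Matrix N N ℂ) (p q : N → ℝ)
    (hp : ∀ i, 0 ≤ p i) (hq : ∀ i, 0 < q i)
    (hU : U.conjTranspose * U = 1) (hV : V.conjTranspose * V = 1) :
    Ffun t (U * Matrix.diagonal (fun i => (p i : ℂ)) * U.conjTranspose)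
      (V * Matrix.diagonal (fun i => (q i : ℂ)) * V.conjTranspose) X ≤
    ∑ x : N × N, Complex.normSq ((U.conjTranspose * V) x.1 x.2) * (p x.1 ^ 2 / (q x.2 + t * p x.1)) := by
  have hX : X = U * (U.conjTranspose * X * V) * V.conjTranspose := by
    have hU' := mul_eq_one_comm.1 hU
    have hV' := mul_eq_one_comm.1 hV
    calc X = (U * U.conjTranspose) * X * (V * V.conjTranspose) := by simp [hU', hV']
      _ = _ := by simp only [Matrix.mul_assoc]
  rw [hX, Ffun_eq t U V _ p q hU hV]
  apply Finset.sum_le_sum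
  rintro ⟨i, j⟩ _
  set y := (U.conjTranspose * X * V) i j with hy
  set w := (U.conjTranspose * V) i j with hw
  have hpos : 0 < q j + t * p i := add_pos_of_pos_of_nonneg (hq j) (mul_nonneg ht (hp i))
  dsimp only
  rw [← mul_div_assoc, le_div_iff₀ hpos]
  simp only [Complex.star_def, Complex.mul_re, Complex.conj_re, Complex.conj_im, Complex.normSq_apply]
  nlinarith [sq_nonneg ((q j + t * p i) * y.re - p i * w.re), sq_nonneg ((q j + t * p i) * y.im - p i * w.im)]

theorem Ffun_attained {N : Type*} [Fintype N] [DecidableEq N] (t : ℝ) (ht : 0 ≤ t) (U V : Matrix N N ℂ) (p q : N → ℝ)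
    (hp : ∀ i, 0 ≤ p i) (hq : ∀ i, 0 < q i)
    (hU : U.conjTranspose * U = 1) (hV : V.conjTranspose * V = 1) :
    ∃ X, Ffun t (U * Matrix.diagonal (fun i => (p i : ℂ)) * U.conjTranspose)
      (V * Matrix.diagonal (fun i => (q i : ℂ)) * V.conjTranspose) X =
    ∑ x : N × N, Complex.normSq ((U.conjTranspose * V) x.1 x.2) * (p x.1 ^ 2 / (q x.2 + t * p x.1)) := by
  refine ⟨U * (Matrix.of fun i j => ((p i / (q j + t * p i) : ℝ) : ℂ) * (U.conjTranspose * V) i j) * V.conjTranspose, ?_⟩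
  rw [Ffun_eq t U V _ p q hU hV]
  apply Finset.sum_congr rfl
  rintro ⟨i, j⟩ _
  set w := (U.conjTranspose * V) i j with hw
  have hpos : 0 < q j + t * p i := add_pos_of_pos_of_nonneg (hq j) (mul_nonneg ht (hp i))
  simp only [Matrix.of_apply, ← hw]
  rw [mul_assoc _ w, Complex.re_ofReal_mul, Complex.star_def, Complex.mul_conj, Complex.ofReal_re,
    Complex.normSq_mul, Complex.normSq_ofReal]
  field_simp
  ring

theorem sum_normSq_row {N : Type*} [Fintype N] [DecidableEq N] (W : Matrix N N ℂ)
    (hW : W * W.conjTranspose = 1) (i : N) : ∑ j, Complex.normSq (W i j) = 1 := by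
  have h := congrFun (congrFun hW i) i
  rw [Matrix.mul_apply, Matrix.one_apply_eq] at h
  simp only [Matrix.conjTranspose_apply, Complex.star_def, Complex.mul_conj] at h
  exact_mod_cast h

theorem diag_conj {N : Type*} [Fintype N] [DecidableEq N] (U V : Matrix N N ℂ) (p : N → ℝ) (j : N) :
    ((V.conjTranspose * (U * Matrix.diagonal (fun i => (p i : ℂ)) * U.conjTranspose) * V) j j).re =
    ∑ i, Complex.normSq ((U.conjTranspose * V) i j) * p i := by
  have : V.conjTranspose * (U * Matrix.diagonal (fun i => (p i : ℂ)) * U.conjTranspose) * V =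
    (U.conjTranspose * V).conjTranspose * (Matrix.diagonal (fun i => (p i : ℂ)) * (U.conjTranspose * V)) := by
    simp only [Matrix.mul_assoc, Matrix.conjTranspose_mul, Matrix.conjTranspose_conjTranspose]
  rw [this, Matrix.mul_apply, Complex.re_sum]
  apply Finset.sum_congr rfl
  intro i _
  rw [Matrix.diagonal_mul, Matrix.conjTranspose_apply, mul_left_comm, Complex.re_ofReal_mul, Complex.star_def, mul_comm _ ((U.conjTranspose * V) i j),
    Complex.mul_conj, Complex.ofReal_re, mul_comm]

theorem uni_mul {K : Type*} [Fintype K] [DecidableEq K] (U V : Matrix K K ℂ)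
    (hU : U.conjTranspose * U = 1) (hV : V.conjTranspose * V = 1) :
    (U.conjTranspose * V) * (U.conjTranspose * V).conjTranspose = 1 := by
  have hV2 := mul_eq_one_comm.1 hV
  calc _ = U.conjTranspose * (V * V.conjTranspose) * U := by
        simp only [Matrix.mul_assoc, Matrix.conjTranspose_mul, Matrix.conjTranspose_conjTranspose]
    _ = 1 := by simp [hV2, hU]

/-- Monotonicity of relative entropy in spectral form. -/
theorem relEnt_mono {N M : Type*} [Fintype N] [DecidableEq N] [Fintype M] [DecidableEq M]
    (ρ σ U V : Matrix N N ℂ) (p q : N → ℝ) (ρ' σ' U' V' : Matrix M M ℂ) (p' q' : M → ℝ)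
    (hp : ∀ i, 0 ≤ p i) (hq : ∀ i, 0 < q i) (hp' : ∀ i, 0 ≤ p' i) (hq' : ∀ i, 0 < q' i)
    (hU : U.conjTranspose * U = 1) (hV : V.conjTranspose * V = 1)
    (hU' : U'.conjTranspose * U' = 1) (hV' : V'.conjTranspose * V' = 1)
    (hρ : ρ = U * Matrix.diagonal (fun i => (p i : ℂ)) * U.conjTranspose)
    (hσ : σ = V * Matrix.diagonal (fun i => (q i : ℂ)) * V.conjTranspose)
    (hρ' : ρ' = U' * Matrix.diagonal (fun i => (p' i : ℂ)) * U'.conjTranspose)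
    (hσ' : σ' = V' * Matrix.diagonal (fun i => (q' i : ℂ)) * V'.conjTranspose)
    (htr : ρ'.trace = ρ.trace)
    (hF : ∀ X', ∃ X, ∀ t, Ffun t ρ' σ' X' = Ffun t ρ σ X) :
    ∑ i, p' i * Real.log (p' i) - ∑ j, ((V'.conjTranspose * ρ' * V') j j).re * Real.log (q' j) ≤
    ∑ i, p i * Real.log (p i) - ∑ j, ((V.conjTranspose * ρ * V) j j).re * Real.log (q j) := by
  have s1 : ∀ (g : N → ℝ), ∑ x : N × N, Complex.normSq ((U.conjTranspose * V) x.1 x.2) * g x.1 = ∑ i, g i := by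
    intro g
    rw [Fintype.sum_prod_type]
    refine Finset.sum_congr rfl fun i _ => ?_
    dsimp only
    rw [← Finset.sum_mul, sum_normSq_row _ (uni_mul U V hU hV), one_mul]
  have s1' : ∀ (g : M → ℝ), ∑ x : M × M, Complex.normSq ((U'.conjTranspose * V') x.1 x.2) * g x.1 = ∑ i, g i := by
    intro g
    rw [Fintype.sum_prod_type]
    refine Finset.sum_congr rfl fun i _ => ?_
    dsimp only
    rw [← Finset.sum_mul, sum_normSq_row _ (uni_mul U' V' hU' hV'), one_mul]
  have tr1 : ρ.trace = ((∑ i, p i : ℝ) : ℂ) := by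
    rw [hρ, Matrix.trace_mul_comm, ← Matrix.mul_assoc, hU, Matrix.one_mul, Matrix.trace_diagonal]; simp
  have tr1' : ρ'.trace = ((∑ i, p' i : ℝ) : ℂ) := by
    rw [hρ', Matrix.trace_mul_comm, ← Matrix.mul_assoc, hU', Matrix.one_mul, Matrix.trace_diagonal]; simp
  have hsum : ∑ i, p' i = ∑ i, p i := by
    rw [tr1, tr1'] at htr; exact_mod_cast htr
  have main := scalar_ineq (fun x : N × N => Complex.normSq ((U.conjTranspose * V) x.1 x.2))
    (fun x => p x.1) (fun x => q x.2) (fun x : M × M => Complex.normSq ((U'.conjTranspose * V') x.1 x.2))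
    (fun x => p' x.1) (fun x => q' x.2) (fun x => hp _) (fun x => hq _) (fun x => hp' _) (fun x => hq' _)
    (by
      intro t ht
      obtain ⟨X', hX'⟩ := Ffun_attained t ht U' V' p' q' hp' hq' hU' hV'
      obtain ⟨X, hX⟩ := hF X'
      rw [← hX', ← hρ', ← hσ', hX t, hρ, hσ]
      exact Ffun_le t ht U V X p q hp hq hU hV)
    (by rw [s1, s1', hsum])
  rw [s1 (fun i => p i * Real.log (p i)), s1' (fun i => p' i * Real.log (p' i))] at main
  have s2 : ∑ j, ((V.conjTranspose * ρ * V) j j).re * Real.log (q j) =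
      ∑ x : N × N, Complex.normSq ((U.conjTranspose * V) x.1 x.2) * (p x.1 * Real.log (q x.2)) := by
    rw [Fintype.sum_prod_type, Finset.sum_comm]
    refine Finset.sum_congr rfl fun j _ => ?_
    rw [hρ, diag_conj, Finset.sum_mul]
    simp only [mul_assoc]
  have s2' : ∑ j, ((V'.conjTranspose * ρ' * V') j j).re * Real.log (q' j) =
      ∑ x : M × M, Complex.normSq ((U'.conjTranspose * V') x.1 x.2) * (p' x.1 * Real.log (q' x.2)) := by
    rw [Fintype.sum_prod_type, Finset.sum_comm]
    refine Finset.sum_congr rfl fun j _ => ?_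
    rw [hρ', diag_conj, Finset.sum_mul]
    simp only [mul_assoc]
  rw [s2, s2']
  exact main

open scoped Kronecker

theorem spectral_data {N : Type*} [Fintype N] [DecidableEq N] (ω : Matrix N N ℂ) (h : ω.PosSemidef) :
    ∃ (U : Matrix N N ℂ) (p : N → ℝ), U.conjTranspose * U = 1 ∧ (∀ i, 0 ≤ p i) ∧
      ω = U * Matrix.diagonal (fun i => (p i : ℂ)) * U.conjTranspose ∧
      vnEntropy ω = - ∑ i, p i * Real.log (p i) := by
  refine ⟨h.1.eigenvectorUnitary, h.1.eigenvalues, ?_, h.eigenvalues_nonneg, ?_, ?_⟩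
  · have := h.1.eigenvectorUnitary.2
    exact (Matrix.mem_unitaryGroup_iff'.1 this)
  · conv_lhs => rw [h.1.spectral_theorem, Unitary.conjStarAlgAut_apply]
    rfl
  · rw [vnEntropy, dif_pos h.1]

theorem vnEntropy_reindex {N K : Type*} [Fintype N] [DecidableEq N] [Fintype K] [DecidableEq K]
    (e : K ≃ N) (ω : Matrix N N ℂ) (h : ω.IsHermitian) :
    vnEntropy (ω.submatrix e e) = vnEntropy ω := by
  have h' : (ω.submatrix e e).IsHermitian := h.submatrix e
  rw [vnEntropy, vnEntropy, dif_pos h, dif_pos h']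
  have hc : (ω.submatrix e e).charpoly = ω.charpoly := by
    have := Matrix.charpoly_reindex e.symm ω
    simpa [Matrix.reindex_apply] using this
  have hr := congrArg Polynomial.roots hc
  rw [h.roots_charpoly_eq_eigenvalues, h'.roots_charpoly_eq_eigenvalues] at hr
  have hr2 := congrArg (fun s => (s.map (fun z : ℂ => z.re * Real.log z.re)).sum) hr
  simp only [Multiset.map_map, Function.comp_def] at hr2
  simpa using hr2

theorem sum_diag_kron {A K : Type*} [Fintype A] [DecidableEq A] [Fintype K] [DecidableEq K]
    (M : Matrix (A × K) (A × K) ℂ) (V : Matrix K K ℂ) (q : K → ℝ) (hV : V.conjTranspose * V = 1)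
    (hω : ∑ a, M.submatrix (Prod.mk a) (Prod.mk a) =
      V * Matrix.diagonal (fun i => (q i : ℂ)) * V.conjTranspose) (g : K → ℝ) :
    ∑ x : A × K, ((((1 : Matrix A A ℂ) ⊗ₖ V).conjTranspose * M * ((1 : Matrix A A ℂ) ⊗ₖ V)) x x).re * g x.2
      = ∑ j, q j * g j := by
  have h1 : ∀ a j, (((1 : Matrix A A ℂ) ⊗ₖ V).conjTranspose * M * ((1 : Matrix A A ℂ) ⊗ₖ V)) (a, j) (a, j)
      = (V.conjTranspose * M.submatrix (Prod.mk a) (Prod.mk a) * V) j j := by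
    intro a j
    simp [Matrix.mul_apply, Fintype.sum_prod_type, Matrix.one_apply, apply_ite (starRingEnd ℂ), ite_mul, Finset.sum_ite_irrel]
  rw [Fintype.sum_prod_type, Finset.sum_comm]
  refine Finset.sum_congr rfl fun j _ => ?_
  dsimp only
  rw [← Finset.sum_mul]
  congr 1
  simp only [h1]
  rw [← Complex.re_sum]
  have h2 : ∑ a, (V.conjTranspose * M.submatrix (Prod.mk a) (Prod.mk a) * V) j j
      = (V.conjTranspose * (∑ a, M.submatrix (Prod.mk a) (Prod.mk a)) * V) j j := by
    rw [Matrix.mul_sum, Matrix.sum_mul, Matrix.sum_apply]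
  rw [h2, hω]
  have h3 : V.conjTranspose * (V * Matrix.diagonal (fun i => (q i : ℂ)) * V.conjTranspose) * V
     = (V.conjTranspose * V) * Matrix.diagonal (fun i => (q i : ℂ)) * (V.conjTranspose * V) := by
    simp only [Matrix.mul_assoc]
  rw [h3, hV]
  simp

theorem kron_spec {A K : Type*} [Fintype A] [DecidableEq A] [Fintype K] [DecidableEq K]
    (ω V : Matrix K K ℂ) (q : K → ℝ) (hV : V.conjTranspose * V = 1)
    (hω : ω = V * Matrix.diagonal (fun i => (q i : ℂ)) * V.conjTranspose) (ε : ℝ) :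
    (1 : Matrix A A ℂ) ⊗ₖ (ω + (ε : ℂ) • 1) = ((1 : Matrix A A ℂ) ⊗ₖ V) *
      Matrix.diagonal (fun x : A × K => ((q x.2 + ε : ℝ) : ℂ)) * ((1 : Matrix A A ℂ) ⊗ₖ V).conjTranspose := by
  have hd : Matrix.diagonal (fun x : A × K => ((q x.2 + ε : ℝ) : ℂ)) =
      (1 : Matrix A A ℂ) ⊗ₖ (Matrix.diagonal (fun i => (q i : ℂ)) + (ε : ℂ) • (1 : Matrix K K ℂ)) := by
    ext ⟨a, j⟩ ⟨a', j'⟩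
    by_cases h1 : a = a' <;> by_cases h2 : j = j' <;>
      simp [h1, h2]
  rw [hd, Matrix.conjTranspose_kronecker, ← Matrix.mul_kronecker_mul, ← Matrix.mul_kronecker_mul]
  congr 1
  · simp
  · rw [Matrix.mul_add, Matrix.add_mul, hω]
    simp [mul_eq_one_comm.1 hV]

theorem kron_unitary {A K : Type*} [Fintype A] [DecidableEq A] [Fintype K] [DecidableEq K]
    (V : Matrix K K ℂ) (hV : V.conjTranspose * V = 1) :
    ((1 : Matrix A A ℂ) ⊗ₖ V).conjTranspose * ((1 : Matrix A A ℂ) ⊗ₖ V) = 1 := by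
  rw [Matrix.conjTranspose_kronecker, ← Matrix.mul_kronecker_mul, hV]
  simp

/-- embedding `X ↦ X ⊗ 1_C` -/
def embC {A B C : Type*} [DecidableEq C] (X : Matrix (A × B) (A × B) ℂ) :
    Matrix (A × (C × B)) (A × (C × B)) ℂ :=
  Matrix.of fun x y => if x.2.1 = y.2.1 then X (x.1, x.2.2) (y.1, y.2.2) else 0

/-- partial trace over `C` -/
def trC {A B C : Type*} [Fintype C] (M : Matrix (A × (C × B)) (A × (C × B)) ℂ) :
    Matrix (A × B) (A × B) ℂ :=
  ∑ c, M.submatrix (fun x => (x.1, (c, x.2))) (fun x => (x.1, (c, x.2)))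

theorem embC_mul {A B C : Type*} [Fintype A] [Fintype B] [Fintype C] [DecidableEq C]
    (X Y : Matrix (A × B) (A × B) ℂ) :
    (embC (X * Y) : Matrix (A × (C × B)) (A × (C × B)) ℂ) = embC X * embC Y := by
  ext ⟨a, c, b⟩ ⟨a', c', b'⟩
  simp only [embC, Matrix.of_apply, Matrix.mul_apply, Fintype.sum_prod_type]
  by_cases h : c = c'
  · subst h
    simp
  · rw [if_neg h]
    symm
    refine Finset.sum_eq_zero fun a _ => Finset.sum_eq_zero fun c2 _ => Finset.sum_eq_zero fun b _ => ?_
    by_cases h2 : c = c2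
    · subst h2; simp [h]
    · simp [h2]

theorem embC_conj {A B C : Type*} [DecidableEq C]
    (X : Matrix (A × B) (A × B) ℂ) :
    (embC X : Matrix (A × (C × B)) (A × (C × B)) ℂ).conjTranspose = embC X.conjTranspose := by
  ext ⟨a, c, b⟩ ⟨a', c', b'⟩
  by_cases h : c = c'
  · simp [embC, h]
  · simp [embC, h, Ne.symm h]

theorem trace_embC {A B C : Type*} [Fintype A] [Fintype B] [Fintype C] [DecidableEq C]
    (M : Matrix (A × (C × B)) (A × (C × B)) ℂ) (X : Matrix (A × B) (A × B) ℂ) :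
    (M * embC X).trace = (trC M * X).trace := by
  simp only [Matrix.trace, Matrix.diag_apply, Matrix.mul_apply, embC, trC, Matrix.of_apply,
    Fintype.sum_prod_type, Matrix.sum_apply, Matrix.submatrix_apply, Finset.sum_mul]
  refine Finset.sum_congr rfl fun a _ => ?_
  rw [Finset.sum_comm]
  refine Finset.sum_congr rfl fun b _ => ?_
  refine Finset.sum_congr rfl fun c _ => ?_
  refine Finset.sum_congr rfl fun a' _ => ?_
  rw [Finset.sum_comm]
  simp

theorem Ffun_embC {A B C : Type*} [Fintype A] [Fintype B] [Fintype C] [DecidableEq C]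
    (t : ℝ) (ρ σ : Matrix (A × (C × B)) (A × (C × B)) ℂ) (X : Matrix (A × B) (A × B) ℂ) :
    Ffun t (trC ρ) (trC σ) X = Ffun t ρ σ (embC X) := by
  rw [Ffun, Ffun, embC_conj, ← embC_mul, ← embC_mul, trace_embC, trace_embC, trace_embC]

theorem psd_sum_sub {N K C : Type*} [Fintype C] (M : Matrix N N ℂ)
    (h : M.PosSemidef) (f : C → K → N) : (∑ c, M.submatrix (f c) (f c)).PosSemidef :=
  Matrix.posSemidef_sum _ fun c _ => h.submatrix (f c)

theorem trC_sum {A B C : Type*} [Fintype A] [Fintype C]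
    (M : Matrix (A × (C × B)) (A × (C × B)) ℂ) :
    ∑ a, (trC M).submatrix (Prod.mk a) (Prod.mk a) =
      ∑ c, (∑ a, M.submatrix (Prod.mk a) (Prod.mk a)).submatrix (Prod.mk c) (Prod.mk c) := by
  ext b b'
  simp only [trC, Matrix.sum_apply, Matrix.submatrix_apply]
  rw [Finset.sum_comm]

theorem trC_kron {A B C : Type*} [DecidableEq A] [Fintype C] [DecidableEq C] [DecidableEq B]
    (ω : Matrix (C × B) (C × B) ℂ) (ε : ℝ) :
    trC ((1 : Matrix A A ℂ) ⊗ₖ (ω + (ε : ℂ) • 1)) =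
      (1 : Matrix A A ℂ) ⊗ₖ ((∑ c, ω.submatrix (Prod.mk c) (Prod.mk c)) +
        ((Fintype.card C * ε : ℝ) : ℂ) • 1) := by
  ext ⟨a, b⟩ ⟨a', b'⟩
  simp only [trC, Matrix.sum_apply, Matrix.submatrix_apply, Matrix.kroneckerMap_apply, Matrix.add_apply,
    Matrix.smul_apply]
  by_cases h : b = b' <;> simp [Matrix.one_apply, h, Finset.sum_add_distrib]

theorem tendsto_qlog {K : Type*} [Fintype K] (q : K → ℝ) (k : ℝ) :
    Filter.Tendsto (fun ε : ℝ => ∑ j, q j * Real.log (q j + k * ε)) (nhdsWithin 0 (Set.Ioi 0))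
      (nhds (∑ j, q j * Real.log (q j))) := by
  refine tendsto_nhdsWithin_of_tendsto_nhds ?_
  apply tendsto_finsetSum
  intro j _
  by_cases h : q j = 0
  · simp [h]
  · apply Filter.Tendsto.const_mul
    have h1 : Filter.Tendsto (fun ε : ℝ => q j + k * ε) (nhds 0) (nhds (q j + k * 0)) :=
      (Filter.tendsto_id.const_mul k).const_add _
    simp only [mul_zero, add_zero] at h1
    exact h1.log h

/-- strong subadditivity -/
theorem ssa {A B C : Type*} [Fintype A] [DecidableEq A] [Fintype B] [DecidableEq B]
    [Fintype C] [DecidableEq C] [Nonempty C]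
    (M : Matrix (A × (C × B)) (A × (C × B)) ℂ) (hM : M.PosSemidef) :
    vnEntropy M + vnEntropy (∑ a, (trC M).submatrix (Prod.mk a) (Prod.mk a)) ≤
      vnEntropy (trC M) + vnEntropy (∑ a, M.submatrix (Prod.mk a) (Prod.mk a)) := by
  have hAB : (trC M).PosSemidef := psd_sum_sub M hM _
  have hCB : (∑ a, M.submatrix (Prod.mk a) (Prod.mk a)).PosSemidef := psd_sum_sub M hM _
  have hB : (∑ a, (trC M).submatrix (Prod.mk a) (Prod.mk a)).PosSemidef := psd_sum_sub _ hAB _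
  obtain ⟨U, p, hU, hp, hMe, hS⟩ := spectral_data M hM
  obtain ⟨U', p', hU', hp', hMe', hS'⟩ := spectral_data _ hAB
  obtain ⟨V, q, hV, hq, hωe, hT⟩ := spectral_data _ hCB
  obtain ⟨V', q', hV', hq', hωe', hT'⟩ := spectral_data _ hB
  have hk : (0:ℝ) < Fintype.card C := by exact_mod_cast Fintype.card_pos
  have key : ∀ ε : ℝ, 0 < ε → ∑ i, p' i * Real.log (p' i) - ∑ j, q' j * Real.log (q' j + Fintype.card C * ε) ≤
      ∑ i, p i * Real.log (p i) - ∑ j, q j * Real.log (q j + 1 * ε) := by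
    intro ε hε
    have h := relEnt_mono M ((1 : Matrix A A ℂ) ⊗ₖ ((∑ a, M.submatrix (Prod.mk a) (Prod.mk a)) + (ε : ℂ) • 1))
      U ((1 : Matrix A A ℂ) ⊗ₖ V) p (fun x => q x.2 + ε)
      (trC M) ((1 : Matrix A A ℂ) ⊗ₖ ((∑ a, (trC M).submatrix (Prod.mk a) (Prod.mk a)) + ((Fintype.card C * ε : ℝ) : ℂ) • 1))
      U' ((1 : Matrix A A ℂ) ⊗ₖ V') p' (fun x => q' x.2 + Fintype.card C * ε)
      hp (fun x => add_pos_of_nonneg_of_pos (hq _) hε) hp'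
      (fun x => add_pos_of_nonneg_of_pos (hq' _) (mul_pos hk hε))
      hU (kron_unitary V hV) hU' (kron_unitary V' hV') hMe (kron_spec _ V q hV hωe ε)
      hMe' (kron_spec _ V' q' hV' hωe' _)
      (by
        have := trace_embC M 1
        rw [Matrix.mul_one] at this
        rw [← this]
        congr 1
        have h1 : (embC 1 : Matrix (A × (C × B)) (A × (C × B)) ℂ) = 1 := by
          ext ⟨a, c, b⟩ ⟨a', c', b'⟩
          by_cases h1 : a = a' <;> by_cases h2 : b = b' <;> by_cases h3 : c = c' <;>
            simp [embC, Matrix.one_apply, h1, h2, h3]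
        rw [h1, Matrix.mul_one])
      (by
        intro X
        refine ⟨embC X, fun t => ?_⟩
        rw [← Ffun_embC, trC_kron, trC_sum])
    rw [sum_diag_kron M V q hV hωe (fun j => Real.log (q j + ε)),
      sum_diag_kron (trC M) V' q' hV' hωe' (fun j => Real.log (q' j + Fintype.card C * ε))] at h
    simpa using h
  have hlim := le_of_tendsto_of_tendsto ((tendsto_qlog q' (Fintype.card C)).const_sub (∑ i, p' i * Real.log (p' i)))
    ((tendsto_qlog q 1).const_sub (∑ i, p i * Real.log (p i)))
    (by filter_upwards [self_mem_nhdsWithin] with ε hε using key ε hε)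
  rw [hS, hS', hT, hT']
  linarith

/-- extend a configuration on `S` to `T = insert i S` by the value `c` at `i`. -/
def extIdx {ι : Type*} [DecidableEq ι] {dim : ι → ℕ} {S T : Finset ι} {i : ι}
    (hT : ∀ j, j ∈ T → j ∉ S → j = i) (c : Fin (dim i))
    (x : (j : {j : ι // j ∈ S}) → Fin (dim j.1)) : (j : {j : ι // j ∈ T}) → Fin (dim j.1) :=
  fun j => if h : j.1 ∈ S then x ⟨j.1, h⟩ else (hT j.1 j.2 h).symm ▸ c

theorem extIdx_mem {ι : Type*} [DecidableEq ι] {dim : ι → ℕ} {S T : Finset ι} {i : ι}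
    (hT : ∀ j, j ∈ T → j ∉ S → j = i) (c : Fin (dim i))
    (x : (j : {j : ι // j ∈ S}) → Fin (dim j.1)) (j : {j : ι // j ∈ T}) (h : j.1 ∈ S) :
    extIdx hT c x j = x ⟨j.1, h⟩ := dif_pos h

theorem extIdx_self {ι : Type*} [DecidableEq ι] {dim : ι → ℕ} {S T : Finset ι} {i : ι}
    (hT : ∀ j, j ∈ T → j ∉ S → j = i) (c : Fin (dim i))
    (x : (j : {j : ι // j ∈ S}) → Fin (dim j.1)) (hi : i ∈ T) (h : i ∉ S) :
    extIdx hT c x ⟨i, hi⟩ = c := dif_neg h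

/-- the equivalence splitting off the factor `i`. -/
def extEquiv {ι : Type*} [DecidableEq ι] {dim : ι → ℕ} {S T : Finset ι} {i : ι}
    (hT : ∀ j, j ∈ T → j ∉ S → j = i) (hST : S ⊆ T) (hi : i ∈ T) (h : i ∉ S) :
    (Fin (dim i) × ((j : {j : ι // j ∈ S}) → Fin (dim j.1))) ≃
      ((j : {j : ι // j ∈ T}) → Fin (dim j.1)) where
  toFun x := extIdx hT x.1 x.2
  invFun y := (y ⟨i, hi⟩, fun j => y ⟨j.1, hST j.2⟩)
  left_inv := by
    rintro ⟨c, x⟩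
    refine Prod.ext ?_ ?_
    · exact extIdx_self hT c x hi h
    · funext j
      exact extIdx_mem hT c x ⟨j.1, hST j.2⟩ j.2
  right_inv := by
    intro y
    funext ⟨j, hj⟩
    by_cases hjS : j ∈ S
    · exact extIdx_mem hT _ _ ⟨j, hj⟩ hjS
    · obtain rfl := hT j hj hjS
      exact extIdx_self hT _ _ hi h

theorem marginal_ext {ι : Type*} [Fintype ι] [DecidableEq ι] {dim : ι → ℕ}
    (ρ : Matrix ((i : ι) → Fin (dim i)) ((i : ι) → Fin (dim i)) ℂ) {S T : Finset ι} {i : ι}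
    (hT : ∀ j, j ∈ T → j ∉ S → j = i) (hST : S ⊆ T) (hi : i ∈ T) (h : i ∉ S)
    (x y : (j : {j : ι // j ∈ S}) → Fin (dim j.1)) :
    marginal ρ S x y = ∑ c, marginal ρ T (extIdx hT c x) (extIdx hT c y) := by
  unfold marginal
  rw [← Fintype.sum_prod_type']
  have aux : ∀ (x : (j : {j : ι // j ∈ S}) → Fin (dim j.1)) (z : (j : {j : ι // j ∉ S}) → Fin (dim j.1)),
      (fun j => if h : j ∈ S then x ⟨j, h⟩ else z ⟨j, h⟩ : (j : ι) → Fin (dim j)) =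
      (fun j => if hj : j ∈ T then extIdx hT (z ⟨i, h⟩) x ⟨j, hj⟩ else z ⟨j, fun hh => hj (hST hh)⟩) := by
    intro x z
    funext j
    by_cases hjT : j ∈ T
    · rw [dif_pos hjT]
      by_cases hjS : j ∈ S
      · rw [dif_pos hjS, extIdx_mem hT _ _ ⟨j, hjT⟩ hjS]
      · obtain rfl := hT j hjT hjS
        rw [dif_neg hjS, extIdx_self hT _ _ hi h]
    · rw [dif_neg hjT, dif_neg (fun hh => hjT (hST hh))]
  refine Finset.sum_bij'
    (i := fun (z : (j : {j : ι // j ∉ S}) → Fin (dim j.1)) _ =>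
      ((z ⟨i, h⟩, fun j => z ⟨j.1, fun hh => j.2 (hST hh)⟩) : Fin (dim i) × ((j : {j : ι // j ∉ T}) → Fin (dim j.1))))
    (j := fun w _ => fun j => if hj : j.1 ∈ T then (hT j.1 hj j.2).symm ▸ w.1 else w.2 ⟨j.1, hj⟩)
    ?_ ?_ ?_ ?_ ?_
  · intros; simp
  · intros; simp
  · intro z _
    funext ⟨j, hj⟩
    by_cases hjT : j ∈ T
    · obtain rfl := hT j hjT hj
      simp [hjT]
    · simp [hjT]
  · rintro ⟨c, w⟩ _
    refine Prod.ext ?_ ?_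
    · simp [hi]
    · funext ⟨j, hj⟩
      simp [hj]
  · intro z _
    rw [aux x z, aux y z]

theorem marginal_psd {ι : Type*} [Fintype ι] [DecidableEq ι] {dim : ι → ℕ}
    (ρ : Matrix ((i : ι) → Fin (dim i)) ((i : ι) → Fin (dim i)) ℂ) (hρ : ρ.PosSemidef) (S : Finset ι) :
    (marginal ρ S).PosSemidef := by
  have : marginal ρ S = ∑ z : (i : {j : ι // j ∉ S}) → Fin (dim i.1),
      ρ.submatrix (fun x i => if h : i ∈ S then x ⟨i, h⟩ else z ⟨i, h⟩)
        (fun x i => if h : i ∈ S then x ⟨i, h⟩ else z ⟨i, h⟩) := by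
    ext x y
    rw [Matrix.sum_apply]
    rfl
  rw [this]
  exact psd_sum_sub ρ hρ _

theorem mEnt_empty {ι : Type*} [Fintype ι] [DecidableEq ι] {dim : ι → ℕ}
    (ρ : Matrix ((i : ι) → Fin (dim i)) ((i : ι) → Fin (dim i)) ℂ) (hρ : ρ.PosSemidef)
    (htr : ρ.trace = 1) : mEnt ρ ∅ = 0 := by
  have hp := marginal_psd ρ hρ ∅
  have htr' : (marginal ρ ∅).trace = 1 := by
    rw [← htr, Matrix.trace, Matrix.trace]
    rw [Fintype.sum_unique]
    simp only [Matrix.diag_apply, marginal]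
    let e : ((i : {j : ι // j ∉ (∅ : Finset ι)}) → Fin (dim i.1)) ≃ ((i : ι) → Fin (dim i)) :=
      ⟨fun z i => z ⟨i, by simp⟩, fun w i => w i.1, fun z => rfl, fun w => rfl⟩
    refine Fintype.sum_equiv e _ _ ?_
    intro z
    have : ∀ x : (i : {j : ι // j ∈ (∅ : Finset ι)}) → Fin (dim i.1), (fun i => if h : i ∈ (∅ : Finset ι) then x ⟨i, h⟩ else z ⟨i, h⟩ : (i : ι) → Fin (dim i)) = fun i => z ⟨i, by simp⟩ := by
      intro x
      funext i
      exact dif_neg (by simp)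
    rw [this]
    rfl
  have hsum := hp.1.trace_eq_sum_eigenvalues
  rw [htr', Fintype.sum_unique] at hsum
  have h1 : hp.1.eigenvalues default = 1 := by
    have := congrArg Complex.re hsum.symm
    simpa using this
  rw [mEnt, vnEntropy, dif_pos hp.1, Fintype.sum_unique, h1]
  simp

theorem mEnt_submodular {ι : Type*} [Fintype ι] [DecidableEq ι] {dim : ι → ℕ}
    (ρ : Matrix ((i : ι) → Fin (dim i)) ((i : ι) → Fin (dim i)) ℂ) (hρ : ρ.PosSemidef)
    (hne : ∀ i, Nonempty (Fin (dim i)))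
    (J : Finset ι) (a i : ι) (ha : a ∉ J) (hi : i ∉ J) (hai : a ≠ i) :
    mEnt ρ (insert a (insert i J)) + mEnt ρ J ≤ mEnt ρ (insert a J) + mEnt ρ (insert i J) := by
  set Ja := insert a J with hJa
  set Ji := insert i J with hJi
  set L := insert a Ji with hL
  -- split maps
  have t1 : ∀ j, j ∈ Ja → j ∉ J → j = a := by intro j h1 h2; simp [hJa] at h1; tauto
  have t2 : ∀ j, j ∈ Ji → j ∉ J → j = i := by intro j h1 h2; simp [hJi] at h1; tauto
  have t3 : ∀ j, j ∈ L → j ∉ Ji → j = a := by intro j h1 h2; simp [hL] at h1; tauto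
  have t4 : ∀ j, j ∈ L → j ∉ Ja → j = i := by
    intro j h1 h2; simp [hL, hJi] at h1; simp [hJa] at h2; tauto
  have m1 : a ∈ Ja := by simp [hJa]
  have m2 : i ∈ Ji := by simp [hJi]
  have m3 : a ∈ L := by simp [hL]
  have m4 : i ∈ L := by simp [hL, hJi]
  have s1 : J ⊆ Ja := Finset.subset_insert _ _
  have s2 : J ⊆ Ji := Finset.subset_insert _ _
  have s3 : Ji ⊆ L := Finset.subset_insert _ _
  have s4 : Ja ⊆ L := Finset.insert_subset_insert _ s2
  have n3 : a ∉ Ji := by simp [hJi, hai, ha]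
  have n4 : i ∉ Ja := by simp [hJa, hai.symm, hi]
  let e1 := extEquiv (dim := dim) t1 s1 m1 ha
  let e2 := extEquiv (dim := dim) t2 s2 m2 hi
  let e4 := extEquiv (dim := dim) t4 s4 m4 n4
  let E : (Fin (dim i) × (Fin (dim a) × ((j : {j : ι // j ∈ J}) → Fin (dim j.1)))) ≃
      ((j : {j : ι // j ∈ L}) → Fin (dim j.1)) := (Equiv.prodCongr (Equiv.refl _) e1).trans e4
  let M := (marginal ρ L).submatrix E E
  have hM : M.PosSemidef := (marginal_psd ρ hρ L).submatrix _
  have comm : ∀ (c : Fin (dim a)) (b : Fin (dim i)) (x : (j : {j : ι // j ∈ J}) → Fin (dim j.1)),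
      extIdx t4 b (extIdx t1 c x) = extIdx t3 c (extIdx t2 b x) := by
    intro c b x
    funext ⟨j, hj⟩
    by_cases hja : j = a
    · subst hja
      rw [extIdx_mem t4 _ _ _ m1, extIdx_self t1 _ _ _ ha, extIdx_self t3 _ _ _ n3]
    · by_cases hji : j = i
      · subst hji
        rw [extIdx_mem t3 _ _ _ m2, extIdx_self t2 _ _ _ hi, extIdx_self t4 _ _ _ n4]
      · have hjJ : j ∈ J := by simp [hL, hJi] at hj; tauto
        rw [extIdx_mem t4 _ _ _ (s1 hjJ), extIdx_mem t1 _ _ _ hjJ,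
          extIdx_mem t3 _ _ _ (s2 hjJ), extIdx_mem t2 _ _ _ hjJ]
  have hAB : trC M = (marginal ρ Ji).submatrix e2 e2 := by
    ext ⟨b, x⟩ ⟨b', y⟩
    rw [trC, Matrix.sum_apply, Matrix.submatrix_apply]
    refine Eq.trans ?_ (marginal_ext ρ t3 s3 m3 n3 (extIdx t2 b x) (extIdx t2 b' y)).symm
    refine Finset.sum_congr rfl fun c _ => ?_
    rw [← comm, ← comm]
    rfl
  have hCB : ∑ b, M.submatrix (Prod.mk b) (Prod.mk b) = (marginal ρ Ja).submatrix e1 e1 := by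
    ext ⟨c, x⟩ ⟨c', y⟩
    rw [Matrix.sum_apply, Matrix.submatrix_apply]
    exact (marginal_ext ρ t4 s4 m4 n4 (extIdx t1 c x) (extIdx t1 c' y)).symm
  have hB : ∑ b, (trC M).submatrix (Prod.mk b) (Prod.mk b) = marginal ρ J := by
    rw [hAB]
    ext x y
    rw [Matrix.sum_apply]
    exact (marginal_ext ρ t2 s2 m2 hi x y).symm
  have h := ssa M hM
  rw [hB, hCB, hAB, vnEntropy_reindex e2 _ (marginal_psd ρ hρ _).1,
    vnEntropy_reindex e1 _ (marginal_psd ρ hρ _).1,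
    vnEntropy_reindex E _ (marginal_psd ρ hρ _).1] at h
  unfold mEnt
  linarith

/-- Han-type inequality -/
theorem han_aux {α : Type*} [DecidableEq α] (f : Finset α → ℝ)
    (hsub : ∀ (J : Finset α) (a i : α), a ∉ J → i ∉ J → a ≠ i →
      f (insert a (insert i J)) + f J ≤ f (insert a J) + f (insert i J)) (I : Finset α) :
    ∑ i ∈ I, (f I - f (I.erase i)) ≤ f I - f ∅ := by
  induction I using Finset.induction_on with
  | empty => simp
  | insert a I ha ih =>
    rw [Finset.sum_insert ha, Finset.erase_insert ha]
    have : ∑ i ∈ I, (f (insert a I) - f ((insert a I).erase i)) ≤ ∑ i ∈ I, (f I - f (I.erase i)) := by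
      apply Finset.sum_le_sum
      intro i hi
      have hai : a ≠ i := by rintro rfl; exact ha hi
      have h := hsub (I.erase i) a i (by simp [ha]) (by simp) hai
      rw [Finset.insert_erase hi] at h
      rw [Finset.erase_insert_of_ne hai]
      linarith
    linarith

theorem avg_step {n : ℕ} (f : Finset (Fin n) → ℝ) (hf : f ∅ = 0)
    (hsub : ∀ (J : Finset (Fin n)) (a i : Fin n), a ∉ J → i ∉ J → a ≠ i →
      f (insert a (insert i J)) + f J ≤ f (insert a J) + f (insert i J)) (k : ℕ) :
    (k : ℝ) * ∑ I ∈ Finset.powersetCard (k+1) Finset.univ, f I ≤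
      ((n - k : ℕ) : ℝ) * ∑ J ∈ Finset.powersetCard k Finset.univ, f J := by
  have h1 : (k : ℝ) * ∑ I ∈ Finset.powersetCard (k+1) Finset.univ, f I ≤
      ∑ I ∈ Finset.powersetCard (k+1) (Finset.univ : Finset (Fin n)), ∑ i ∈ I, f (I.erase i) := by
    rw [Finset.mul_sum]
    apply Finset.sum_le_sum
    intro I hI
    have hc := (Finset.mem_powersetCard.1 hI).2
    have h := han_aux f hsub I
    rw [Finset.sum_sub_distrib, Finset.sum_const, hc, hf] at h
    simp only [nsmul_eq_mul] at h
    push_cast at h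
    linarith
  refine h1.trans (le_of_eq ?_)
  rw [Finset.mul_sum]
  have h2 : ∀ J ∈ Finset.powersetCard k (Finset.univ : Finset (Fin n)),
      ((n - k : ℕ) : ℝ) * f J = ∑ i ∈ Jᶜ, f J := by
    intro J hJ
    have hc := (Finset.mem_powersetCard.1 hJ).2
    rw [Finset.sum_const, Finset.card_compl, hc, Fintype.card_fin, nsmul_eq_mul]
  rw [Finset.sum_congr rfl h2, Finset.sum_sigma', Finset.sum_sigma']
  refine Finset.sum_bij' (fun x _ => ⟨x.1.erase x.2, x.2⟩) (fun x _ => ⟨insert x.2 x.1, x.2⟩) ?_ ?_ ?_ ?_ ?_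
  · rintro ⟨I, i⟩ h
    simp only [Finset.mem_sigma, Finset.mem_powersetCard] at h ⊢
    simp [Finset.card_erase_of_mem h.2, h.1.2]
  · rintro ⟨I, i⟩ h
    simp only [Finset.mem_sigma, Finset.mem_powersetCard, Finset.mem_compl] at h ⊢
    simp [Finset.card_insert_of_notMem h.2, h.1.2]
  · rintro ⟨I, i⟩ h
    simp only [Finset.mem_sigma, Finset.mem_powersetCard] at h ⊢
    simp [Finset.insert_erase h.2]
  · rintro ⟨I, i⟩ h
    simp only [Finset.mem_sigma, Finset.mem_powersetCard, Finset.mem_compl] at h ⊢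
    simp [Finset.erase_insert h.2]
  · rintro ⟨I, i⟩ h
    rfl

theorem avg_final {n μ m : ℕ} (hμ : 1 ≤ μ) (hμm : μ < m) (hmn : m ≤ n)
    (f : Finset (Fin n) → ℝ) (hf : f ∅ = 0)
    (hsub : ∀ (J : Finset (Fin n)) (a i : Fin n), a ∉ J → i ∉ J → a ≠ i →
      f (insert a (insert i J)) + f J ≤ f (insert a J) + f (insert i J)) :
    (∑ I ∈ Finset.powersetCard m (Finset.univ : Finset (Fin n)), f I)
        / (n.choose m : ℝ)
      ≤ (m : ℝ) / (μ : ℝ) *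
        ((∑ J ∈ Finset.powersetCard μ (Finset.univ : Finset (Fin n)), f J)
          / (n.choose μ : ℝ)) := by
  obtain ⟨d, rfl⟩ : ∃ d, m = μ + d := ⟨m - μ, by omega⟩
  clear hμm
  induction d with
  | zero =>
    have : (μ : ℝ) ≠ 0 := by positivity
    simp [this]
  | succ d ih =>
    specialize ih (by omega)
    set k := μ + d with hk
    have hkn : k + 1 ≤ n := hmn
    have hs := avg_step f hf hsub k
    set A := ∑ I ∈ Finset.powersetCard (k+1) (Finset.univ : Finset (Fin n)), f I with hA
    set B := ∑ I ∈ Finset.powersetCard k (Finset.univ : Finset (Fin n)), f I with hB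
    set C := (∑ J ∈ Finset.powersetCard μ (Finset.univ : Finset (Fin n)), f J) / (n.choose μ : ℝ)
    change A / (n.choose (k+1) : ℝ) ≤ ((k+1 : ℕ) : ℝ) / μ * C
    have hk0 : (0:ℝ) < k := by exact_mod_cast (by omega : 0 < k)
    have hμ0 : (0:ℝ) < μ := by exact_mod_cast hμ
    have hch : (0:ℝ) < n.choose k := by exact_mod_cast Nat.choose_pos (by omega)
    have hch1 : (0:ℝ) < n.choose (k+1) := by exact_mod_cast Nat.choose_pos hkn
    have hrec : (n.choose (k+1) : ℝ) * ((k:ℝ)+1) = n.choose k * ((n-k : ℕ) : ℝ) := by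
      exact_mod_cast Nat.choose_succ_right_eq n k
    have h3 : A / (n.choose (k+1) : ℝ) ≤ ((k:ℝ)+1)/k * (B / n.choose k) := by
      rw [div_mul_div_comm, div_le_div_iff₀ hch1 (by positivity)]
      have : (k:ℝ) * A * n.choose k ≤ (((n-k : ℕ) : ℝ) * B) * n.choose k :=
        mul_le_mul_of_nonneg_right hs hch.le
      calc _ = (k:ℝ) * A * n.choose k := by ring
        _ ≤ _ := this
        _ = B * (n.choose k * ((n-k : ℕ) : ℝ)) := by ring
        _ = _ := by rw [← hrec]; ring
    refine h3.trans ?_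
    calc ((k:ℝ)+1)/k * (B / n.choose k) ≤ ((k:ℝ)+1)/k * ((k:ℝ) / μ * C) :=
          mul_le_mul_of_nonneg_left ih (by positivity)
      _ = _ := by push_cast; field_simp

/-- For a state `ρ` on `X_1 ⊗ ⋯ ⊗ X_n` and `1 ≤ μ < m ≤ n`,
`E_{|I|=m} S(X_I) ≤ (m/μ) E_{|J|=μ} S(X_J)`. -/
theorem avg_entropy_subsets
    (n μ m : ℕ) (hμ : 1 ≤ μ) (hμm : μ < m) (hmn : m ≤ n)
    (dim : Fin n → ℕ)
    (ρ : Matrix ((i : Fin n) → Fin (dim i)) ((i : Fin n) → Fin (dim i)) ℂ)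
    (hpsd : ρ.PosSemidef) (htr : ρ.trace = 1) :
    (∑ I ∈ Finset.powersetCard m (Finset.univ : Finset (Fin n)), mEnt ρ I)
        / (n.choose m : ℝ)
      ≤ (m : ℝ) / (μ : ℝ) *
        ((∑ J ∈ Finset.powersetCard μ (Finset.univ : Finset (Fin n)), mEnt ρ J)
          / (n.choose μ : ℝ)) := by
  have hne : Nonempty ((i : Fin n) → Fin (dim i)) := by
    by_contra hcon
    rw [not_nonempty_iff] at hcon
    simp [Matrix.trace] at htr
  obtain ⟨x0⟩ := hne
  exact avg_final hμ hμm hmn (mEnt ρ) (mEnt_empty ρ hpsd htr)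
    (mEnt_submodular ρ hpsd (fun i => ⟨x0 i⟩))
end

section
/- Let n ≥ 2 and let ρ be a quantum state on a composite system X_1 ⊗ … ⊗ X_n ⊗ Y of finite-dimensional systems. Then S(X_1⋯X_n | Y)_ρ ≤ (1/(n−1)) · ∑_{i=1}^n S(X_{{1,…,n}∖{i}} | Y)_ρ. -/
open scoped BigOperators ComplexOrder

open Matrix

/-- variational functional expressed in two eigenbases -/
lemma ssa_tr_basis {n : Type*} [Fintype n] [DecidableEq n] (U V Y : Matrix n n ℂ)
    (hU : Uᴴ * U = 1) (hV : Vᴴ * V = 1) (p q : n → ℂ) :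
    ((U * diagonal p * Uᴴ) * (U * Y * Vᴴ)).trace = ∑ i, ∑ j, p i * Y i j * star ((Uᴴ * V) i j)
    ∧ ((U * diagonal p * Uᴴ) * ((U * Y * Vᴴ) * (U * Y * Vᴴ)ᴴ)).trace
        = ∑ i, ∑ j, p i * (Y i j * star (Y i j))
    ∧ ((V * diagonal q * Vᴴ) * ((U * Y * Vᴴ)ᴴ * (U * Y * Vᴴ))).trace
        = ∑ i, ∑ j, q j * (Y i j * star (Y i j)) := by
  refine ⟨?_, ?_, ?_⟩
  · have : (U * diagonal p * Uᴴ) * (U * Y * Vᴴ) = U * (diagonal p * (Y * Vᴴ)) := by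
      calc _ = U * diagonal p * (Uᴴ * U) * Y * Vᴴ := by simp only [Matrix.mul_assoc]
        _ = _ := by rw [hU]; simp only [Matrix.mul_assoc, Matrix.one_mul]
    rw [this, trace_mul_comm]
    have h2 : diagonal p * (Y * Vᴴ) * U = diagonal p * (Y * (Uᴴ * V)ᴴ) := by
      rw [conjTranspose_mul, conjTranspose_conjTranspose]; simp only [Matrix.mul_assoc]
    rw [h2]
    simp [trace, diagonal_mul, Matrix.mul_apply (M := Y), Finset.mul_sum, mul_assoc, -conjTranspose_mul]
  · have : (U * diagonal p * Uᴴ) * ((U * Y * Vᴴ) * (U * Y * Vᴴ)ᴴ)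
        = U * (diagonal p * (Y * Yᴴ) * Uᴴ) := by
      calc _ = U * diagonal p * (Uᴴ * U) * Y * (Vᴴ * V) * Yᴴ * Uᴴ := by
            simp only [conjTranspose_mul, conjTranspose_conjTranspose, Matrix.mul_assoc]
        _ = _ := by rw [hU, hV]; simp only [Matrix.mul_assoc, Matrix.one_mul]
    rw [this, trace_mul_comm, Matrix.mul_assoc, hU, Matrix.mul_one]
    simp [trace, diagonal_mul, Matrix.mul_apply (M := Y), Finset.mul_sum]
  · have : (V * diagonal q * Vᴴ) * ((U * Y * Vᴴ)ᴴ * (U * Y * Vᴴ))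
        = V * (diagonal q * (Yᴴ * Y) * Vᴴ) := by
      calc _ = V * diagonal q * (Vᴴ * V) * Yᴴ * (Uᴴ * U) * Y * Vᴴ := by
            simp only [conjTranspose_mul, conjTranspose_conjTranspose, Matrix.mul_assoc]
        _ = _ := by rw [hU, hV]; simp only [Matrix.mul_assoc, Matrix.one_mul]
    rw [this, trace_mul_comm, Matrix.mul_assoc, hV, Matrix.mul_one, Finset.sum_comm]
    simp [trace, diagonal_mul, Matrix.mul_apply (M := Yᴴ), Finset.mul_sum, mul_comm]

/-- scalar inequality -/
lemma ssa_scalar (p c : ℝ) (hc : 0 ≤ c) (h0 : c = 0 → p = 0) (y w : ℂ) :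
    2 * ((p : ℂ) * y * star w).re - c * Complex.normSq y ≤ Complex.normSq w * p ^ 2 / c := by
  rcases hc.eq_or_lt with h | h
  · have := h0 h.symm
    subst this; subst h; simp
  · rw [le_div_iff₀ h]
    simp [Complex.normSq_apply]
    nlinarith [sq_nonneg (c * y.re - p * w.re), sq_nonneg (c * y.im - p * w.im)]

lemma ssa_scalar_eq (p c : ℝ) (h0 : c = 0 → p = 0) (w : ℂ) :
    2 * ((p : ℂ) * (((p / c : ℝ) : ℂ) * w) * star w).re
      - c * Complex.normSq (((p / c : ℝ) : ℂ) * w) = Complex.normSq w * p ^ 2 / c := by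
  by_cases h : c = 0
  · have := h0 h
    subst this; subst h; simp
  · simp [Complex.normSq_apply, -Complex.ofReal_div]
    field_simp
    ring

/-- the functional -/
noncomputable def ssaJ {n : Type*} [Fintype n] (ρ σ : Matrix n n ℂ) (t : ℝ) (X : Matrix n n ℂ) : ℝ :=
  2 * (ρ * X).trace.re - (σ * (Xᴴ * X)).trace.re - t * (ρ * (X * Xᴴ)).trace.re

noncomputable def ssaQ {n : Type*} [Fintype n] (U V : Matrix n n ℂ) (p q : n → ℝ) (t : ℝ) : ℝ :=
  ∑ i, ∑ j, Complex.normSq ((Uᴴ * V) i j) * (p i) ^ 2 / (q j + t * p i)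

lemma ssaJ_eq {n : Type*} [Fintype n] [DecidableEq n] (U V Y : Matrix n n ℂ)
    (hU : Uᴴ * U = 1) (hV : Vᴴ * V = 1) (p q : n → ℝ) (t : ℝ) :
    ssaJ (U * diagonal (fun i => (p i : ℂ)) * Uᴴ) (V * diagonal (fun i => (q i : ℂ)) * Vᴴ) t
      (U * Y * Vᴴ) = ∑ i, ∑ j, (2 * ((p i : ℂ) * Y i j * star ((Uᴴ * V) i j)).re
        - (q j + t * p i) * Complex.normSq (Y i j)) := by
  obtain ⟨h1, h2, h3⟩ := ssa_tr_basis U V Y hU hV (fun i => (p i : ℂ)) (fun i => (q i : ℂ))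
  unfold ssaJ
  rw [h1, h2, h3]
  have hy : ∀ (r : ℝ) (z : ℂ), ((r : ℂ) * (z * star z)).re = r * Complex.normSq z := by
    intro r z
    rw [Complex.star_def, Complex.mul_conj, ← Complex.ofReal_mul, Complex.ofReal_re]
  simp only [Complex.re_sum, hy, Finset.mul_sum, ← Finset.sum_sub_distrib]
  refine Finset.sum_congr rfl fun i _ => Finset.sum_congr rfl fun j _ => ?_
  ring

lemma ssaJ_le {n : Type*} [Fintype n] [DecidableEq n] (U V : Matrix n n ℂ)
    (hU : Uᴴ * U = 1) (hV : Vᴴ * V = 1) (p q : n → ℝ) (hp : ∀ i, 0 ≤ p i) (hq : ∀ i, 0 ≤ q i)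
    (t : ℝ) (ht : 0 < t) (X : Matrix n n ℂ) :
    ssaJ (U * diagonal (fun i => (p i : ℂ)) * Uᴴ) (V * diagonal (fun i => (q i : ℂ)) * Vᴴ) t X
      ≤ ssaQ U V p q t := by
  have hX : X = U * (Uᴴ * X * V) * Vᴴ := by
    calc X = (U * Uᴴ) * X * (V * Vᴴ) := by
          rw [mul_eq_one_comm.mp hU, mul_eq_one_comm.mp hV]; simp
      _ = _ := by simp only [Matrix.mul_assoc]
  rw [hX, ssaJ_eq _ _ _ hU hV]
  refine Finset.sum_le_sum fun i _ => Finset.sum_le_sum fun j _ => ?_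
  have h1 := mul_nonneg ht.le (hp i)
  refine ssa_scalar _ _ (add_nonneg (hq j) h1) (fun h => ?_) _ _
  have h2 : t * p i = 0 := by linarith [hq j]
  simpa [ht.ne'] using h2

lemma ssaJ_attain {n : Type*} [Fintype n] [DecidableEq n] (U V : Matrix n n ℂ)
    (hU : Uᴴ * U = 1) (hV : Vᴴ * V = 1) (p q : n → ℝ) (hp : ∀ i, 0 ≤ p i) (hq : ∀ i, 0 ≤ q i)
    (t : ℝ) (ht : 0 < t) : ∃ X : Matrix n n ℂ,
    ssaJ (U * diagonal (fun i => (p i : ℂ)) * Uᴴ) (V * diagonal (fun i => (q i : ℂ)) * Vᴴ) t X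
      = ssaQ U V p q t := by
  refine ⟨U * (Matrix.of fun i j => ((p i / (q j + t * p i) : ℝ) : ℂ) * (Uᴴ * V) i j) * Vᴴ, ?_⟩
  rw [ssaJ_eq _ _ _ hU hV]
  refine Finset.sum_congr rfl fun i _ => Finset.sum_congr rfl fun j _ => ?_
  have h1 := mul_nonneg ht.le (hp i)
  refine ssa_scalar_eq _ _ (fun h => ?_) _
  have h2 : t * p i = 0 := by linarith [hq j]
  simpa [ht.ne'] using h2

lemma ssa_row {n : Type*} [Fintype n] [DecidableEq n] (U V : Matrix n n ℂ)
    (hU : Uᴴ * U = 1) (hV : Vᴴ * V = 1) (i : n) :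
    ∑ j, Complex.normSq ((Uᴴ * V) i j) = 1 := by
  have h : (Uᴴ * V) * (Uᴴ * V)ᴴ = 1 := by
    rw [conjTranspose_mul, conjTranspose_conjTranspose]
    calc _ = Uᴴ * (V * Vᴴ) * U := by simp only [Matrix.mul_assoc]
      _ = 1 := by rw [mul_eq_one_comm.mp hV]; simpa using hU
  have h2 := congrFun (congrFun h i) i
  rw [Matrix.mul_apply] at h2
  simp only [conjTranspose_apply, Complex.star_def, Complex.mul_conj, one_apply_eq] at h2
  exact_mod_cast h2

noncomputable def ssaF {n : Type*} [Fintype n] (U V : Matrix n n ℂ) (p q : n → ℝ) (t : ℝ) : ℝ :=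
  ∑ i, ∑ j, Complex.normSq ((Uᴴ * V) i j) * p i * (Real.log (q j + t * p i) - Real.log (q j))

def ssaSupp {n : Type*} [Fintype n] (U V : Matrix n n ℂ) (p q : n → ℝ) : Prop :=
  ∀ i j, Complex.normSq ((Uᴴ * V) i j) * p i ≠ 0 → q j ≠ 0

lemma ssaF_deriv {n : Type*} [Fintype n] (U V : Matrix n n ℂ) (p q : n → ℝ)
    (hp : ∀ i, 0 ≤ p i) (hq : ∀ i, 0 ≤ q i) (hs : ssaSupp U V p q) (t : ℝ) (ht : 0 ≤ t) :
    HasDerivAt (ssaF U V p q) (ssaQ U V p q t) t := by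
  unfold ssaF ssaQ
  refine HasDerivAt.fun_sum fun i _ => HasDerivAt.fun_sum fun j _ => ?_
  by_cases h : Complex.normSq ((Uᴴ * V) i j) * p i = 0
  · have h2 : Complex.normSq ((Uᴴ * V) i j) * (p i) ^ 2 = 0 := by
      rw [pow_two, ← mul_assoc, h, zero_mul]
    simp only [h, h2, zero_mul, zero_div]
    exact hasDerivAt_const _ _
  · have hq' : 0 < q j := lt_of_le_of_ne (hq j) (hs i j h).symm
    have hc : 0 < q j + t * p i := by have := mul_nonneg ht (hp i); linarith
    have h1 : HasDerivAt (fun t => q j + t * p i) (p i) t := by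
      simpa using ((hasDerivAt_id t).mul_const (p i)).const_add (q j)
    have h2 := ((h1.log hc.ne').sub_const (Real.log (q j))).const_mul
      (Complex.normSq ((Uᴴ * V) i j) * p i)
    refine h2.congr_deriv ?_
    ring

noncomputable def ssaD {n : Type*} [Fintype n] (U V : Matrix n n ℂ) (p q : n → ℝ) : ℝ :=
  ∑ i, ∑ j, Complex.normSq ((Uᴴ * V) i j) * p i * (Real.log (p i) - Real.log (q j))

lemma ssaF_lim {n : Type*} [Fintype n] [DecidableEq n] (U V : Matrix n n ℂ)
    (hU : Uᴴ * U = 1) (hV : Vᴴ * V = 1) (p q : n → ℝ)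
    (hp : ∀ i, 0 ≤ p i) (hq : ∀ i, 0 ≤ q i) :
    Filter.Tendsto (fun t => ssaF U V p q t - (∑ i, p i) * Real.log t) Filter.atTop
      (nhds (ssaD U V p q)) := by
  have e : ∀ t : ℝ, ssaF U V p q t - (∑ i, p i) * Real.log t = ∑ i, ∑ j,
      Complex.normSq ((Uᴴ * V) i j) * p i *
        (Real.log (q j + t * p i) - Real.log (q j) - Real.log t) := by
    intro t
    unfold ssaF
    rw [Finset.sum_mul, ← Finset.sum_sub_distrib]
    refine Finset.sum_congr rfl fun i _ => ?_
    simp only [mul_sub _ _ (Real.log t), Finset.sum_sub_distrib]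
    rw [← Finset.sum_mul, ← Finset.sum_mul, ssa_row U V hU hV, one_mul]
  simp only [e]
  unfold ssaD
  refine tendsto_finsetSum _ fun i _ => tendsto_finsetSum _ fun j _ => ?_
  rcases (hp i).eq_or_lt with h | h
  · simp [← h]
  · refine Filter.Tendsto.const_mul _ ?_
    have h1 : Filter.Tendsto (fun t : ℝ => q j * t⁻¹ + p i) Filter.atTop (nhds (p i)) := by
      simpa using (tendsto_inv_atTop_zero.const_mul (q j)).add_const (p i)
    have h2 := (h1.log h.ne').sub_const (Real.log (q j))
    refine h2.congr' ?_
    filter_upwards [Filter.eventually_gt_atTop (0:ℝ)] with t ht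
    have : q j + t * p i = (q j * t⁻¹ + p i) * t := by field_simp
    have h3 : 0 < q j * t⁻¹ + p i := by have := hq j; positivity
    rw [this, Real.log_mul h3.ne' ht.ne']
    ring

lemma ssa_mono {n m : Type*} [Fintype n] [DecidableEq n] [Fintype m] [DecidableEq m]
    (U V : Matrix n n ℂ) (hU : Uᴴ * U = 1) (hV : Vᴴ * V = 1) (p q : n → ℝ)
    (hp : ∀ i, 0 ≤ p i) (hq : ∀ i, 0 ≤ q i) (hs : ssaSupp U V p q)
    (U' V' : Matrix m m ℂ) (hU' : U'ᴴ * U' = 1) (hV' : V'ᴴ * V' = 1) (p' q' : m → ℝ)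
    (hp' : ∀ i, 0 ≤ p' i) (hq' : ∀ i, 0 ≤ q' i) (hs' : ssaSupp U' V' p' q')
    (hsum : ∑ i, p i = ∑ i, p' i)
    (hJ : ∀ t X, ∃ Z,
      ssaJ (U * diagonal (fun i => (p i : ℂ)) * Uᴴ) (V * diagonal (fun i => (q i : ℂ)) * Vᴴ) t Z
      = ssaJ (U' * diagonal (fun i => (p' i : ℂ)) * U'ᴴ)
        (V' * diagonal (fun i => (q' i : ℂ)) * V'ᴴ) t X) :
    ssaD U' V' p' q' ≤ ssaD U V p q := by
  have hQ : ∀ t, 0 < t → ssaQ U' V' p' q' t ≤ ssaQ U V p q t := by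
    intro t ht
    obtain ⟨X, hX⟩ := ssaJ_attain U' V' hU' hV' p' q' hp' hq' t ht
    obtain ⟨Z, hZ⟩ := hJ t X
    rw [← hX, ← hZ]
    exact ssaJ_le U V hU hV p q hp hq t ht Z
  have hd : ∀ t, 0 ≤ t → HasDerivAt (fun t => ssaF U V p q t - ssaF U' V' p' q' t)
      (ssaQ U V p q t - ssaQ U' V' p' q' t) t := fun t ht =>
    (ssaF_deriv U V p q hp hq hs t ht).sub (ssaF_deriv U' V' p' q' hp' hq' hs' t ht)
  have hm : MonotoneOn (fun t => ssaF U V p q t - ssaF U' V' p' q' t) (Set.Ici 0) := by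
    refine monotoneOn_of_deriv_nonneg (convex_Ici 0) ?_ ?_ ?_
    · exact fun t ht => (hd t ht).continuousAt.continuousWithinAt
    · intro t ht
      exact (hd t (interior_subset ht)).differentiableAt.differentiableWithinAt
    · intro t ht
      rw [interior_Ici] at ht
      rw [(hd t (le_of_lt ht)).deriv]
      linarith [hQ t ht]
  refine le_of_tendsto_of_tendsto (ssaF_lim U' V' hU' hV' p' q' hp' hq')
    (ssaF_lim U V hU hV p q hp hq) ?_
  filter_upwards [Filter.eventually_ge_atTop (0:ℝ)] with t ht
  have := hm (Set.mem_Ici.mpr le_rfl) (Set.mem_Ici.mpr ht) ht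
  simp [ssaF] at this
  rw [hsum]
  simp only [ssaF]
  linarith

lemma vnEntropy_submatrix {m n : Type*} [Fintype m] [DecidableEq m] [Fintype n] [DecidableEq n]
    (M : Matrix m m ℂ) (e : n ≃ m) : vnEntropy (M.submatrix e e) = vnEntropy M := by
  by_cases h : M.IsHermitian
  · have h' : (M.submatrix e e).IsHermitian := h.submatrix e
    have hc : (M.submatrix e e).charpoly = M.charpoly := by
      have := Matrix.charpoly_reindex e.symm M
      simpa [Matrix.reindex_apply] using this
    have h1 := h.roots_charpoly_eq_eigenvalues
    have h2 := h'.roots_charpoly_eq_eigenvalues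
    rw [hc, h1] at h2
    have h4 := congrArg (fun s => (Multiset.map (fun x : ℂ => x.re * Real.log x.re) s).sum) h2
    simp only [Multiset.map_map, Function.comp_def, RCLike.ofReal_eq_complex_ofReal,
      Complex.ofReal_re] at h4
    unfold vnEntropy
    rw [dif_pos h, dif_pos h']
    exact congrArg Neg.neg h4.symm
  · have h' : ¬ (M.submatrix e e).IsHermitian := by
      intro h'
      apply h
      have := h'.submatrix e.symm
      simpa using this
    unfold vnEntropy
    rw [dif_neg h, dif_neg h']

lemma ssa_spectral {n : Type*} [Fintype n] [DecidableEq n] (M : Matrix n n ℂ) (h : M.PosSemidef) :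
    ∃ (U : Matrix n n ℂ) (p : n → ℝ), Uᴴ * U = 1 ∧ (∀ i, 0 ≤ p i) ∧
      M = U * diagonal (fun i => (p i : ℂ)) * Uᴴ ∧
      vnEntropy M = - ∑ i, p i * Real.log (p i) := by
  refine ⟨h.1.eigenvectorUnitary, h.1.eigenvalues, ?_, h.eigenvalues_nonneg, ?_, ?_⟩
  · exact Unitary.coe_star_mul_self h.1.eigenvectorUnitary
  · exact h.1.spectral_theorem
  · unfold vnEntropy
    rw [dif_pos h.1]

/-- partial trace over the second factor -/
def ptr {m b : Type*} [Fintype b] (M : Matrix (m × b) (m × b) ℂ) : Matrix m m ℂ :=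
  fun x x' => ∑ y, M (x, y) (x', y)

lemma ptr_posSemidef {m b : Type*} [Fintype b] [Fintype m] (M : Matrix (m × b) (m × b) ℂ)
    (h : M.PosSemidef) : (ptr M).PosSemidef := by
  have : ptr M = ∑ y, M.submatrix (fun x => (x, y)) (fun x => (x, y)) := by
    ext x x'
    simp [ptr, Matrix.sum_apply]
  rw [this]
  exact Matrix.posSemidef_sum _ fun y _ => h.submatrix _

lemma trace_ptr {m b : Type*} [Fintype b] [Fintype m] [DecidableEq b]
    (M : Matrix (m × b) (m × b) ℂ) (X : Matrix m m ℂ) :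
    (M * kroneckerMap (· * ·) X (1 : Matrix b b ℂ)).trace = (ptr M * X).trace := by
  simp only [trace, diag, Matrix.mul_apply, kroneckerMap_apply, Fintype.sum_prod_type, ptr,
    Matrix.one_apply, mul_ite, mul_one, mul_zero, Finset.sum_ite_eq', Finset.mem_univ, if_true,
    Finset.sum_mul]
  refine Finset.sum_congr rfl fun x _ => ?_
  rw [Finset.sum_comm]

lemma ssaJ_ptr {m b : Type*} [Fintype b] [Fintype m] [DecidableEq b] [DecidableEq m]
    (ρ σ : Matrix (m × b) (m × b) ℂ) (t : ℝ) (X : Matrix m m ℂ) :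
    ssaJ ρ σ t (kroneckerMap (· * ·) X (1 : Matrix b b ℂ)) = ssaJ (ptr ρ) (ptr σ) t X := by
  unfold ssaJ
  have h1 : (kroneckerMap (· * ·) X (1 : Matrix b b ℂ))ᴴ
      = kroneckerMap (· * ·) Xᴴ (1 : Matrix b b ℂ) := by
    rw [Matrix.conjTranspose_kronecker, conjTranspose_one]
  rw [h1, ← Matrix.mul_kronecker_mul, ← Matrix.mul_kronecker_mul, Matrix.one_mul,
    trace_ptr, trace_ptr, trace_ptr]

/-- cross term -/
lemma ssa_cross {n : Type*} [Fintype n] [DecidableEq n] (U V : Matrix n n ℂ)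
    (p q : n → ℝ) :
    ∑ i, ∑ j, Complex.normSq ((Uᴴ * V) i j) * p i * q j
      = ((U * diagonal (fun i => (p i : ℂ)) * Uᴴ) *
        (V * diagonal (fun i => (q i : ℂ)) * Vᴴ)).trace.re := by
  have : ((U * diagonal (fun i => (p i : ℂ)) * Uᴴ) *
        (V * diagonal (fun i => (q i : ℂ)) * Vᴴ)) =
      U * ((diagonal (fun i => (p i : ℂ))) * ((Uᴴ * V) * (diagonal (fun i => (q i : ℂ)) * Vᴴ))) := by
    simp only [Matrix.mul_assoc]
  rw [this, trace_mul_comm]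
  have h2 : diagonal (fun i => (p i : ℂ)) * (Uᴴ * V * (diagonal (fun i => (q i : ℂ)) * Vᴴ)) * U
     = diagonal (fun i => (p i : ℂ)) * ((Uᴴ * V) * (diagonal (fun i => (q i : ℂ)) * (Uᴴ * V)ᴴ)) := by
    rw [conjTranspose_mul, conjTranspose_conjTranspose]; simp only [Matrix.mul_assoc]
  rw [h2]
  generalize Uᴴ * V = W
  simp only [trace, diag, diagonal_mul, Matrix.mul_apply (M := W), conjTranspose_apply,
    Finset.mul_sum, Complex.re_sum]
  refine Finset.sum_congr rfl fun i _ => Finset.sum_congr rfl fun j _ => ?_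
  have : (p i : ℂ) * (W i j * ((q j : ℂ) * star (W i j)))
      = ((p i * q j * Complex.normSq (W i j) : ℝ) : ℂ) := by
    push_cast
    rw [← Complex.mul_conj, Complex.star_def]; ring
  rw [this, Complex.ofReal_re]; ring

/-- Data for `D(ρ ‖ σ)` when `σ = ω ⊗ 1` (up to reindexing) and `ω` the marginal of `ρ`. -/
lemma ssa_rel {N m a : Type*} [Fintype N] [DecidableEq N] [Fintype m] [DecidableEq m]
    [Fintype a] [DecidableEq a] (e : N ≃ m × a)
    (U : Matrix N N ℂ) (hU : Uᴴ * U = 1) (p : N → ℝ) (hp : ∀ i, 0 ≤ p i)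
    (V : Matrix m m ℂ) (hV : Vᴴ * V = 1) (q : m → ℝ)
    (hω : ptr ((U * diagonal (fun i => (p i : ℂ)) * Uᴴ).submatrix e.symm e.symm)
        = V * diagonal (fun i => (q i : ℂ)) * Vᴴ) :
    ∃ (V₁ : Matrix N N ℂ) (q₁ : N → ℝ), V₁ᴴ * V₁ = 1 ∧ (∀ i, q₁ i = q (e i).1) ∧
      V₁ * diagonal (fun i => (q₁ i : ℂ)) * V₁ᴴ =
        (kroneckerMap (· * ·) (V * diagonal (fun i => (q i : ℂ)) * Vᴴ)
          (1 : Matrix a a ℂ)).submatrix e e ∧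
      ssaSupp U V₁ p q₁ ∧
      ssaD U V₁ p q₁ = ∑ i, p i * Real.log (p i) - ∑ j, q j * Real.log (q j) := by
  obtain ⟨V₁, hV₁⟩ : ∃ V₁ : Matrix N N ℂ,
    V₁ = (kroneckerMap (· * ·) V (1 : Matrix a a ℂ)).submatrix e e := ⟨_, rfl⟩
  have hc : V₁ᴴ = (kroneckerMap (· * ·) Vᴴ (1 : Matrix a a ℂ)).submatrix e e := by
    rw [hV₁, conjTranspose_submatrix, Matrix.conjTranspose_kronecker, conjTranspose_one]
  have hV₁1 : V₁ᴴ * V₁ = 1 := by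
    rw [hc, hV₁, Matrix.submatrix_mul_equiv, ← Matrix.mul_kronecker_mul, hV]
    simp
  have hfun : ∀ g : m → ℝ, V₁ * diagonal (fun i => (g (e i).1 : ℂ)) * V₁ᴴ =
        (kroneckerMap (· * ·) (V * diagonal (fun i => (g i : ℂ)) * Vᴴ)
          (1 : Matrix a a ℂ)).submatrix e e := by
    intro g
    have hd : diagonal (fun i => (g (e i).1 : ℂ)) =
        (kroneckerMap (· * ·) (diagonal (fun i => (g i : ℂ))) (1 : Matrix a a ℂ)).submatrix e e := by
      rw [← diagonal_one, Matrix.diagonal_kronecker_diagonal, Matrix.submatrix_diagonal_equiv]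
      simp [Function.comp_def]
    rw [hc, hV₁, hd, Matrix.submatrix_mul_equiv, Matrix.submatrix_mul_equiv,
      ← Matrix.mul_kronecker_mul, ← Matrix.mul_kronecker_mul]
    simp
  have hcross : ∀ g : ℝ → ℝ, ∑ i, ∑ j, Complex.normSq ((Uᴴ * V₁) i j) * p i * g (q (e j).1)
      = ∑ j, q j * g (q j) := by
    intro g
    rw [ssa_cross U V₁ p (fun j => g (q (e j).1)), hfun (fun j => g (q j))]
    have h1 : ∀ (A : Matrix N N ℂ) (B : Matrix (m × a) (m × a) ℂ),
        (A * B.submatrix e e).trace = (A.submatrix e.symm e.symm * B).trace := by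
      intro A B
      have : A * B.submatrix e e = (A.submatrix e.symm e.symm * B).submatrix e e := by
        rw [← Matrix.submatrix_mul_equiv _ _ e e e]; simp
      rw [this]
      exact Fintype.sum_equiv e _ _ fun i => rfl
    rw [h1, trace_ptr, hω]
    have h2 : (V * diagonal (fun i => (q i : ℂ)) * Vᴴ *
        (V * diagonal (fun i => (g (q i) : ℂ)) * Vᴴ)) =
        V * (diagonal (fun i => (q i : ℂ)) * (diagonal (fun i => (g (q i) : ℂ)) * Vᴴ)) := by
      calc _ = V * diagonal (fun i => (q i : ℂ)) * (Vᴴ * V) *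
          diagonal (fun i => (g (q i) : ℂ)) * Vᴴ := by simp only [Matrix.mul_assoc]
        _ = _ := by rw [hV]; simp only [Matrix.mul_assoc, Matrix.one_mul]
    rw [h2, trace_mul_comm, Matrix.mul_assoc, Matrix.mul_assoc, hV, Matrix.mul_one,
      diagonal_mul_diagonal, trace_diagonal]
    simp
  refine ⟨V₁, fun i => q (e i).1, hV₁1, fun _ => rfl, hfun q, ?_, ?_⟩
  · intro i j hij hq0
    have h := hcross (fun x => if x = 0 then 1 else 0)
    have hz : ∑ j, q j * (if q j = 0 then (1:ℝ) else 0) = 0 := by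
      refine Finset.sum_eq_zero fun j _ => ?_
      split_ifs with h <;> simp [h]
    rw [hz] at h
    have hnn : ∀ i j, 0 ≤ Complex.normSq ((Uᴴ * V₁) i j) * p i *
        (if q (e j).1 = 0 then (1:ℝ) else 0) := by
      intro i j
      have h1 := Complex.normSq_nonneg ((Uᴴ * V₁) i j)
      have h2 := hp i
      split_ifs <;> positivity
    rw [Finset.sum_eq_zero_iff_of_nonneg
      (fun i _ => Finset.sum_nonneg fun j _ => hnn i j)] at h
    have h1 := h i (Finset.mem_univ _)
    rw [Finset.sum_eq_zero_iff_of_nonneg (fun j _ => hnn i j)] at h1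
    have h2 := h1 j (Finset.mem_univ _)
    rw [if_pos hq0, mul_one] at h2
    exact hij h2
  · unfold ssaD
    simp only [mul_sub, Finset.sum_sub_distrib]
    rw [hcross Real.log]
    congr 1
    refine Finset.sum_congr rfl fun i _ => ?_
    rw [← Finset.sum_mul, ← Finset.sum_mul, ssa_row U V₁ hU hV₁1, one_mul]

/-- trace from spectral data -/
lemma ssa_trace {n : Type*} [Fintype n] [DecidableEq n] (U : Matrix n n ℂ) (p : n → ℝ)
    (hU : Uᴴ * U = 1) :
    (U * diagonal (fun i => (p i : ℂ)) * Uᴴ).trace = ((∑ i, p i : ℝ) : ℂ) := by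
  rw [Matrix.mul_assoc, trace_mul_comm, Matrix.mul_assoc, hU, Matrix.mul_one, trace_diagonal]
  simp

/-- strong subadditivity -/
lemma ssa_prod {a b c : Type*} [Fintype a] [DecidableEq a] [Fintype b] [DecidableEq b]
    [Fintype c] [DecidableEq c] (ρ : Matrix ((a × c) × b) ((a × c) × b) ℂ) (h : ρ.PosSemidef)
    (e : (a × c) × b ≃ (b × c) × a) (he : ∀ x y z, e ((x, z), y) = ((y, z), x)) :
    vnEntropy ρ + vnEntropy (ptr ((ptr ρ).submatrix Prod.swap Prod.swap))
      ≤ vnEntropy (ptr ρ) + vnEntropy (ptr (ρ.submatrix e.symm e.symm)) := by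
  obtain ⟨U, p, hU, hp, hρ, hE⟩ := ssa_spectral ρ h
  obtain ⟨U', p', hU', hp', hρ', hE'⟩ := ssa_spectral (ptr ρ) (ptr_posSemidef _ h)
  obtain ⟨V, q, hV, hq, hω, hEω⟩ := ssa_spectral (ptr (ρ.submatrix e.symm e.symm))
    (ptr_posSemidef _ (h.submatrix _))
  obtain ⟨V', q', hV', hq', hω', hEω'⟩ := ssa_spectral (ptr ((ptr ρ).submatrix Prod.swap Prod.swap))
    (ptr_posSemidef _ ((ptr_posSemidef _ h).submatrix _))
  obtain ⟨V₁, q₁, hV₁, hq₁, hσ, hs, hD⟩ := ssa_rel e U hU p hp V hV q (by rw [← hρ, ← hω])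
  obtain ⟨V₁', q₁', hV₁', hq₁', hσ', hs', hD'⟩ := ssa_rel (Equiv.prodComm a c) U' hU' p' hp' V' hV' q'
    (by rw [← hρ', ← hω']; rfl)
  have key := ssa_mono U V₁ hU hV₁ p q₁ hp (fun i => by rw [hq₁]; exact hq _) hs
    U' V₁' hU' hV₁' p' q₁' hp' (fun i => by rw [hq₁']; exact hq' _) hs' ?_ ?_
  · rw [hD, hD'] at key
    rw [hE, hE', hEω, hEω']
    linarith
  · have h1 := ssa_trace U p hU
    have h2 := ssa_trace U' p' hU'
    rw [← hρ] at h1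
    rw [← hρ'] at h2
    have h3 : ρ.trace = (ptr ρ).trace := by
      simp [trace, ptr, Fintype.sum_prod_type]
    rw [h1, h2] at h3
    exact_mod_cast h3
  · intro t X
    refine ⟨kroneckerMap (· * ·) X (1 : Matrix b b ℂ), ?_⟩
    rw [ssaJ_ptr, hσ, hσ', ← hρ, ← hρ', ← hω, ← hω']
    congr 1
    ext ⟨x, z⟩ ⟨x', z'⟩
    have hes : ∀ x y z, e.symm ((y, z), x) = ((x, z), y) := by
      intro x y z; rw [← he, Equiv.symm_apply_apply]
    simp only [ptr, submatrix_apply, kroneckerMap_apply, he, hes, Equiv.prodComm_apply,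
      Prod.swap_prod_mk]
    have hx : ∀ k : ℂ, (∑ y, (∑ x₁, ρ ((x₁, z), y) ((x₁, z'), y)) * k)
        = (∑ x₁, ∑ y, ρ ((x₁, z), y) ((x₁, z'), y)) * k := by
      intro k
      rw [← Finset.sum_mul, Finset.sum_comm]
    have hy := hx ((1 : Matrix a a ℂ) x x')
    exact hy

def splitEquiv {ι : Type*} (dim : ι → ℕ) (S P R : ι → Prop) [DecidablePred P]
    (h : ∀ i, S i ↔ P i ∨ R i) (hd : ∀ i, P i → ¬ R i) :
    ((i : {i // P i}) → Fin (dim i.1)) × ((i : {i // R i}) → Fin (dim i.1)) ≃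
      ((i : {i // S i}) → Fin (dim i.1)) where
  toFun x := fun i => if hP : P i.1 then x.1 ⟨i.1, hP⟩ else
    x.2 ⟨i.1, ((h i.1).mp i.2).resolve_left hP⟩
  invFun y := (fun i => y ⟨i.1, (h i.1).mpr (Or.inl i.2)⟩,
    fun i => y ⟨i.1, (h i.1).mpr (Or.inr i.2)⟩)
  left_inv := by
    rintro ⟨a, c⟩
    refine Prod.ext ?_ ?_
    · funext i
      simp [i.2]
    · funext i
      have : ¬ P i.1 := fun hP => hd _ hP i.2
      simp [this]
  right_inv := by
    intro y
    funext i
    by_cases hP : P i.1 <;> simp [hP]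

/-- relabelling configurations -/
def congrEquiv {ι : Type*} (dim : ι → ℕ) (S Q : ι → Prop) (h : ∀ i, S i ↔ Q i) :
    ((i : {i // Q i}) → Fin (dim i.1)) ≃ ((i : {i // S i}) → Fin (dim i.1)) where
  toFun x := fun i => x ⟨i.1, (h i.1).mp i.2⟩
  invFun y := fun i => y ⟨i.1, (h i.1).mpr i.2⟩
  left_inv := fun _ => rfl
  right_inv := fun _ => rfl

lemma mEnt_glue {ι : Type*} [Fintype ι] [DecidableEq ι] {dim : ι → ℕ}
    (ρ : Matrix ((i : ι) → Fin (dim i)) ((i : ι) → Fin (dim i)) ℂ) (S : Finset ι)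
    {A B : Type*} [Fintype A] [DecidableEq A] [Fintype B]
    (f : A ≃ ((i : {j : ι // j ∈ S}) → Fin (dim i.1)))
    (g : B ≃ ((i : {j : ι // j ∉ S}) → Fin (dim i.1)))
    (G : A → B → (i : ι) → Fin (dim i))
    (hG : ∀ a b i, G a b i = if h : i ∈ S then f a ⟨i, h⟩ else g b ⟨i, h⟩)
    (M : Matrix A A ℂ) (hM : ∀ a a', M a a' = ∑ b, ρ (G a b) (G a' b)) :
    mEnt ρ S = vnEntropy M := by
  unfold mEnt
  rw [← vnEntropy_submatrix _ f]
  congr 1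
  ext a a'
  rw [hM, submatrix_apply]
  unfold marginal
  refine (Fintype.sum_equiv g _ _ fun b => ?_).symm
  rw [funext (hG a b), funext (hG a' b)]

lemma ssa_finset {ι : Type*} [Fintype ι] [DecidableEq ι] {dim : ι → ℕ}
    (ρ : Matrix ((i : ι) → Fin (dim i)) ((i : ι) → Fin (dim i)) ℂ) (hρ : ρ.PosSemidef)
    (P Q : Finset ι) (W R PR QR : Finset ι) (hW : ∀ i, i ∈ W)
    (h1 : ∀ i, i ∈ PR ↔ i ∈ P ∨ i ∈ R) (h2 : ∀ i, i ∈ QR ↔ i ∈ Q ∨ i ∈ R)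
    (h3 : ∀ i, i ∈ P ∨ i ∈ Q ∨ i ∈ R)
    (hPQ : ∀ i, i ∈ P → i ∉ Q) (hPR : ∀ i, i ∈ P → i ∉ R) (hQR : ∀ i, i ∈ Q → i ∉ R) :
    mEnt ρ W + mEnt ρ R ≤ mEnt ρ PR + mEnt ρ QR := by
  let A := (i : {j : ι // j ∈ P}) → Fin (dim i.1)
  let B := (i : {j : ι // j ∈ Q}) → Fin (dim i.1)
  let C := (i : {j : ι // j ∈ R}) → Fin (dim i.1)
  let fPR : A × C ≃ ((i : {j : ι // j ∈ PR}) → Fin (dim i.1)) :=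
    splitEquiv dim (· ∈ PR) (· ∈ P) (· ∈ R) h1 hPR
  let fQR : B × C ≃ ((i : {j : ι // j ∈ QR}) → Fin (dim i.1)) :=
    splitEquiv dim (· ∈ QR) (· ∈ Q) (· ∈ R) h2 hQR
  let gPR : B ≃ ((i : {j : ι // j ∉ PR}) → Fin (dim i.1)) :=
    congrEquiv dim (· ∉ PR) (· ∈ Q) (by grind)
  let gQR : A ≃ ((i : {j : ι // j ∉ QR}) → Fin (dim i.1)) :=
    congrEquiv dim (· ∉ QR) (· ∈ P) (by grind)
  let gR : A × B ≃ ((i : {j : ι // j ∉ R}) → Fin (dim i.1)) :=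
    splitEquiv dim (· ∉ R) (· ∈ P) (· ∈ Q) (by grind) hPQ
  let fW : ((i : ι) → Fin (dim i)) ≃ ((i : {j : ι // j ∈ W}) → Fin (dim i.1)) :=
    { toFun := fun x i => x i.1
      invFun := fun y i => y ⟨i, hW i⟩
      left_inv := fun _ => rfl
      right_inv := fun _ => rfl }
  have : IsEmpty {j : ι // j ∉ W} := ⟨fun j => j.2 (hW j.1)⟩
  let gW : Unit ≃ ((i : {j : ι // j ∉ W}) → Fin (dim i.1)) :=
    (Equiv.ofUnique _ _)
  let e0 : (A × C) × B ≃ ((i : ι) → Fin (dim i)) :=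
    { toFun := fun x i => if hP : i ∈ P then x.1.1 ⟨i, hP⟩ else
        if hQ : i ∈ Q then x.2 ⟨i, hQ⟩ else x.1.2 ⟨i, by have := h3 i; tauto⟩
      invFun := fun y => ((fun i => y i.1, fun i => y i.1), fun i => y i.1)
      left_inv := by
        rintro ⟨⟨a, c⟩, b⟩
        refine Prod.ext (Prod.ext ?_ ?_) ?_
        · funext i
          simp [i.2]
        · funext i
          have q1 : i.1 ∉ P := fun h => hPR _ h i.2
          have q2 : i.1 ∉ Q := fun h => hQR _ h i.2
          simp [q1, q2]
        · funext i
          have q1 : i.1 ∉ P := fun h => hPQ _ h i.2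
          simp [q1, i.2]
      right_inv := by
        intro y
        funext i
        simp }
  let e : (A × C) × B ≃ (B × C) × A :=
    { toFun := fun x => ((x.2, x.1.2), x.1.1)
      invFun := fun x => ((x.2, x.1.2), x.1.1)
      left_inv := fun _ => rfl
      right_inv := fun _ => rfl }
  have key := ssa_prod (ρ.submatrix e0 e0) (hρ.submatrix _) e (fun _ _ _ => rfl)
  rw [vnEntropy_submatrix] at key
  have m1 : mEnt ρ W = vnEntropy ρ :=
    mEnt_glue ρ W fW gW (fun x _ => x) (fun a b i => by rw [dif_pos (hW i)]; rfl) ρ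
      (fun a a' => by simp)
  have m2 : mEnt ρ PR = vnEntropy (ptr (ρ.submatrix e0 e0)) := by
    refine mEnt_glue ρ PR fPR gPR (fun x b => e0 (x, b)) (fun x b i => ?_) _ (fun x x' => rfl)
    simp only [e0, fPR, gPR, splitEquiv, congrEquiv, Equiv.coe_fn_mk]
    grind
  have m3 : mEnt ρ QR = vnEntropy (ptr ((ρ.submatrix e0 e0).submatrix e.symm e.symm)) := by
    refine mEnt_glue ρ QR fQR gQR (fun x a => e0 ((a, x.2), x.1)) (fun x b i => ?_) _
      (fun x x' => rfl)
    simp only [e0, fQR, gQR, splitEquiv, congrEquiv, Equiv.coe_fn_mk]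
    grind
  have m4 : mEnt ρ R = vnEntropy (ptr ((ptr (ρ.submatrix e0 e0)).submatrix Prod.swap Prod.swap)) := by
    refine mEnt_glue ρ R (Equiv.refl C) gR (fun c x => e0 ((x.1, c), x.2)) (fun x b i => ?_) _
      (fun x x' => ?_)
    · simp only [e0, gR, splitEquiv, Equiv.coe_fn_mk, Equiv.refl_apply]
      grind
    · rw [Fintype.sum_prod_type]; rfl
  rw [m1, m2, m3, m4]
  exact key

/-- `S(X_1⋯X_n|Y) ≤ (1/(n-1)) ∑_i S(X_{[n]∖{i}}|Y)` for `n ≥ 2`. -/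
theorem cond_entropy_leave_one_out
    (n : ℕ) (hn : 2 ≤ n)
    (dim : Fin n ⊕ Unit → ℕ)
    (ρ : Matrix ((i : Fin n ⊕ Unit) → Fin (dim i))
                ((i : Fin n ⊕ Unit) → Fin (dim i)) ℂ)
    (hpsd : ρ.PosSemidef) (htr : ρ.trace = 1) :
    mEnt ρ ((Finset.univ : Finset (Fin n)).image Sum.inl
          ∪ ({Sum.inr ()} : Finset (Fin n ⊕ Unit)))
        - mEnt ρ ({Sum.inr ()} : Finset (Fin n ⊕ Unit))
      ≤ (1 / ((n : ℝ) - 1)) *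
        ∑ i : Fin n,
          (mEnt ρ (((Finset.univ : Finset (Fin n)).erase i).image Sum.inl
              ∪ ({Sum.inr ()} : Finset (Fin n ⊕ Unit)))
            - mEnt ρ ({Sum.inr ()} : Finset (Fin n ⊕ Unit))) := by
  classical
  set E : Finset (Fin n) → ℝ := fun T => mEnt ρ (Tᶜ.image Sum.inl
    ∪ ({Sum.inr ()} : Finset (Fin n ⊕ Unit))) with hE
  have hstep : ∀ (j : Fin n) (T : Finset (Fin n)), j ∉ T →
      E ∅ + E (insert j T) ≤ E T + E {j} := by
    intro j T hj
    refine ssa_finset ρ hpsd (({j} : Finset (Fin n)).image Sum.inl) (T.image Sum.inl) _ _ _ _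
      ?_ ?_ ?_ ?_ ?_ ?_ ?_
    all_goals rintro (i | i) <;> simp
    all_goals grind
  have hind : ∀ T : Finset (Fin n), ∑ i ∈ T, (E ∅ - E {i}) ≤ E ∅ - E T := by
    intro T
    induction T using Finset.induction_on with
    | empty => simp
    | insert j T hj ih =>
      rw [Finset.sum_insert hj]
      linarith [hstep j T hj]
  have hfin := hind Finset.univ
  have e1 : mEnt ρ ((Finset.univ : Finset (Fin n)).image Sum.inl
          ∪ ({Sum.inr ()} : Finset (Fin n ⊕ Unit))) = E ∅ := by
    rw [hE]; simp
  have e2 : mEnt ρ ({Sum.inr ()} : Finset (Fin n ⊕ Unit)) = E Finset.univ := by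
    simp only [hE, Finset.compl_univ, Finset.image_empty, Finset.empty_union]
  have e3 : ∀ i, mEnt ρ (((Finset.univ : Finset (Fin n)).erase i).image Sum.inl
              ∪ ({Sum.inr ()} : Finset (Fin n ⊕ Unit))) = E {i} := by
    intro i
    have : (Finset.univ : Finset (Fin n)).erase i = ({i} : Finset (Fin n))ᶜ := by
      ext x; simp
    rw [this]
  simp only [e3]
  rw [e1, e2]
  have hn' : (0 : ℝ) < (n : ℝ) - 1 := by
    have : (2 : ℝ) ≤ n := by exact_mod_cast hn
    linarith
  rw [one_div, ← div_eq_inv_mul, le_div_iff₀ hn']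
  simp only [Finset.sum_sub_distrib, Finset.sum_const, Finset.card_univ, Fintype.card_fin,
    nsmul_eq_mul] at hfin ⊢
  linarith
end
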